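/- arXiv:2006.00902 — 3 statements merged into one kernel-verified Lean document; each statement's English description precedes it below -/
import Mathlib

section
/- There exist absolute constants C₀ > 0 and c > 0 such that the following holds for all n ≥ 2, d ≥ 1, p ≥ 2d + 1 and σ > 0: if σ ≤ C₀ √((p−2d)/(p+d)) · n^{1/4} d^{-3/4}, then with probability at least 1 − c/n (over the Gaussian noise Δ = σW) the SDP relaxation has a unique global maximizer X̂ of rank exactly d, X̂ = R̂R̂ᵀ for some global maximizer R̂ of the program (P) with orthogonal d×d blocks, and every local maximizer S ∈ St(d,p)^{⊗n} of f satisfies SSᵀ = X̂. -/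
open Matrix MeasureTheory ProbabilityTheory
open scoped BigOperators ENNReal

noncomputable section

/-- Frobenius inner product `⟨X, Y⟩ = Tr (X Yᵀ)`. -/
def finner {m k : Type*} [Fintype m] [Fintype k] (X Y : Matrix m k ℝ) : ℝ :=
  ∑ i, ∑ j, X i j * Y i j

/-- Frobenius norm. -/
def frobNorm {m k : Type*} [Fintype m] [Fintype k] (X : Matrix m k ℝ) : ℝ :=
  Real.sqrt (∑ i, ∑ j, (X i j) ^ 2)

/-- Spectral (ℓ²-operator) norm of a real matrix. -/
def opNorm {m k : Type*} [Fintype m] [Fintype k] [DecidableEq k] (X : Matrix m k ℝ) : ℝ :=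
  ‖LinearMap.toContinuousLinearMap (Matrix.toEuclideanLin X)‖

/-- The `(i,j)` d×d block of an (nd)×(nd) matrix. -/
def blk {n d : ℕ} (M : Matrix (Fin n × Fin d) (Fin n × Fin d) ℝ) (i j : Fin n) :
    Matrix (Fin d) (Fin d) ℝ := fun k l => M (i, k) (j, l)

/-- The i-th d×p block row of an (nd)×p matrix. -/
def rowBlk {n d p : ℕ} (S : Matrix (Fin n × Fin d) (Fin p) ℝ) (i : Fin n) :
    Matrix (Fin d) (Fin p) ℝ := fun k l => S (i, k) l

/-- The i-th (nd)×d block column of an (nd)×(nd) matrix. -/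
def colBlk {n d : ℕ} (M : Matrix (Fin n × Fin d) (Fin n × Fin d) ℝ) (i : Fin n) :
    Matrix (Fin n × Fin d) (Fin d) ℝ := fun q l => M q (i, l)

/-- All d×p block rows lie in the Stiefel manifold St(d,p) (for p = d: are orthogonal). -/
def StiefelBlocks {n d p : ℕ} (S : Matrix (Fin n × Fin d) (Fin p) ℝ) : Prop :=
  ∀ i, rowBlk S i * (rowBlk S i)ᵀ = 1

/-- The vertical stack Z of n copies of the identity I_d. -/
def Zmat (n d : ℕ) : Matrix (Fin n × Fin d) (Fin d) ℝ := fun q l => if q.2 = l then 1 else 0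

/-- Feasibility for the SDP relaxation: symmetric, PSD, identity diagonal blocks. -/
def sdpFeasible {n d : ℕ} (X : Matrix (Fin n × Fin d) (Fin n × Fin d) ℝ) : Prop :=
  X.IsSymm ∧ X.PosSemidef ∧ ∀ i, blk X i i = 1

/-- Global maximizer of the SDP relaxation with data `A`. -/
def sdpMaximizer {n d : ℕ} (A X : Matrix (Fin n × Fin d) (Fin n × Fin d) ℝ) : Prop :=
  sdpFeasible X ∧ ∀ Y, sdpFeasible Y → finner A Y ≤ finner A X

/-- Global maximizer of the program (P) with data `A`. -/
def progPMaximizer {n d : ℕ} (A : Matrix (Fin n × Fin d) (Fin n × Fin d) ℝ)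
    (R : Matrix (Fin n × Fin d) (Fin d) ℝ) : Prop :=
  StiefelBlocks R ∧
    ∀ R' : Matrix (Fin n × Fin d) (Fin d) ℝ, StiefelBlocks R' →
      finner A (R' * R'ᵀ) ≤ finner A (R * Rᵀ)

/-- The distance `d_F(S, Z) = min_{Q ∈ St(d,p)} ‖S − ZQ‖_F`. -/
def dF {n d p : ℕ} (S : Matrix (Fin n × Fin d) (Fin p) ℝ) : ℝ :=
  sInf {c | ∃ Q : Matrix (Fin d) (Fin p) ℝ, Q * Qᵀ = 1 ∧ c = frobNorm (S - Zmat n d * Q)}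

/-- `Λ_{ii}(S) = (1/2) Σ_j (S_i S_jᵀ A_{ji} + A_{ij} S_j S_iᵀ)`. -/
def Lam {n d p : ℕ} (A : Matrix (Fin n × Fin d) (Fin n × Fin d) ℝ)
    (S : Matrix (Fin n × Fin d) (Fin p) ℝ) (i : Fin n) : Matrix (Fin d) (Fin d) ℝ :=
  (1 / 2 : ℝ) •
    ∑ j, (rowBlk S i * (rowBlk S j)ᵀ * blk A j i + blk A i j * rowBlk S j * (rowBlk S i)ᵀ)

/-- Block diagonal matrix with given d×d diagonal blocks. -/
def blkDiag {n d : ℕ} (D : Fin n → Matrix (Fin d) (Fin d) ℝ) :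
    Matrix (Fin n × Fin d) (Fin n × Fin d) ℝ :=
  fun q r => if q.1 = r.1 then D q.1 q.2 r.2 else 0

/-- Local maximizer of `f(S) = ⟨A, S Sᵀ⟩` over `St(d,p)^{⊗n}`. -/
def isLocalMax {n d p : ℕ} (A : Matrix (Fin n × Fin d) (Fin n × Fin d) ℝ)
    (S : Matrix (Fin n × Fin d) (Fin p) ℝ) : Prop :=
  StiefelBlocks S ∧ ∃ ε > (0 : ℝ), ∀ S' : Matrix (Fin n × Fin d) (Fin p) ℝ,
    StiefelBlocks S' → frobNorm (S' - S) < ε → finner A (S' * S'ᵀ) ≤ finner A (S * Sᵀ)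

/-- First-order criticality: `Σ_j A_{ij} S_j = Λ_{ii}(S) S_i` for all i. -/
def firstOrderCrit {n d p : ℕ} (A : Matrix (Fin n × Fin d) (Fin n × Fin d) ℝ)
    (S : Matrix (Fin n × Fin d) (Fin p) ℝ) : Prop :=
  ∀ i, (∑ j, blk A i j * rowBlk S j) = Lam A S i * rowBlk S i

/-- Second-order necessary inequality over tangent directions. -/
def secondOrderIneq {n d p : ℕ} (A : Matrix (Fin n × Fin d) (Fin n × Fin d) ℝ)
    (S : Matrix (Fin n × Fin d) (Fin p) ℝ) : Prop :=
  ∀ Y : Matrix (Fin n × Fin d) (Fin p) ℝ,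
    (∀ i, rowBlk S i * (rowBlk Y i)ᵀ + rowBlk Y i * (rowBlk S i)ᵀ = 0) →
    ∑ i, ∑ j, finner (blk A i j) (rowBlk Y i * (rowBlk Y j)ᵀ) ≤
      ∑ i, finner (Lam A S i) (rowBlk Y i * (rowBlk Y i)ᵀ)

/-- Second-order critical point of `f`. -/
def secondOrderCrit {n d p : ℕ} (A : Matrix (Fin n × Fin d) (Fin n × Fin d) ℝ)
    (S : Matrix (Fin n × Fin d) (Fin p) ℝ) : Prop :=
  StiefelBlocks S ∧ firstOrderCrit A S ∧ secondOrderIneq A S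

/-- Partial trace `Tr_d(Δ) ∈ ℝ^{n×n}`. -/
def partialTrace {n d : ℕ} (Δ : Matrix (Fin n × Fin d) (Fin n × Fin d) ℝ) :
    Matrix (Fin n) (Fin n) ℝ := fun i j => (blk Δ i j).trace

/-- Singular values of a d×p real matrix (square roots of the eigenvalues of `M Mᴴ`). -/
def singVals {d p : ℕ} (M : Matrix (Fin d) (Fin p) ℝ) (i : Fin d) : ℝ :=
  Real.sqrt ((Matrix.isHermitian_mul_conjTranspose_self M).eigenvalues i)

/-- Nuclear norm: sum of singular values. -/
def nuclearNorm {d p : ℕ} (M : Matrix (Fin d) (Fin p) ℝ) : ℝ :=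
  ∑ i, singVals M i

/-- The law of the iid standard Gaussian coordinates indexing the noise. -/
def gaussianEnsemble (n d : ℕ) :
    Measure (((Fin n × Fin d) × (Fin n × Fin d)) → ℝ) :=
  Measure.pi fun _ => gaussianReal 0 1

/-- The symmetric Gaussian random matrix `W` built from the iid coordinates:
`W_{ii} = 0`, the entries of `W_{ij}` for `i < j` are iid standard Gaussians, and
`W_{ji} = W_{ij}ᵀ`. -/
def Wof {n d : ℕ} (ω : ((Fin n × Fin d) × (Fin n × Fin d)) → ℝ) :
    Matrix (Fin n × Fin d) (Fin n × Fin d) ℝ :=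
  fun q r => if q.1 < r.1 then ω (q, r) else if r.1 < q.1 then ω (r, q) else 0

section Calculus

variable {n d p : ℕ}

lemma finner_eq_trace {m k : Type*} [Fintype m] [Fintype k] (X Y : Matrix m k ℝ) :
    finner X Y = (X * Yᵀ).trace := by
  simp [finner, Matrix.trace, Matrix.mul_apply]

lemma finner_mul_transpose {m k : Type*} [Fintype m] [Fintype k] (A : Matrix m m ℝ)
    (X Y : Matrix m k ℝ) : finner A (X * Yᵀ) = finner (A * Y) X := by
  rw [finner_eq_trace, finner_eq_trace, Matrix.transpose_mul, Matrix.transpose_transpose,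
    Matrix.mul_assoc]

lemma finner_mul_transpose_comm {m k : Type*} [Fintype m] [Fintype k] {A : Matrix m m ℝ}
    (hA : A.IsSymm) (X Y : Matrix m k ℝ) : finner A (X * Yᵀ) = finner A (Y * Xᵀ) := by
  simp only [finner]
  rw [Finset.sum_comm]
  refine Finset.sum_congr rfl fun i _ => Finset.sum_congr rfl fun j _ => ?_
  rw [hA.apply i j]
  congr 1
  simp only [Matrix.mul_apply, Matrix.transpose_apply]
  exact Finset.sum_congr rfl fun l _ => mul_comm _ _

lemma IsLocalMax.second_derivative_nonpos {g g' : ℝ → ℝ} {c : ℝ} (hmax : IsLocalMax g 0)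
    (h1 : ∀ t, HasDerivAt g (g' t) t) (h2 : HasDerivAt g' c 0) : g' 0 = 0 ∧ c ≤ 0 := by
  have h0 : g' 0 = 0 := hmax.hasDerivAt_eq_zero (h1 0)
  refine ⟨h0, ?_⟩
  by_contra! hc
  have hd : deriv g = g' := funext fun t => (h1 t).deriv
  have hmin : IsLocalMin g 0 := isLocalMin_of_deriv_deriv_pos
    (by rw [hd, h2.deriv]; exact hc) (by rw [hd, h0]) (h1 0).continuousAt
  have heq : g =ᶠ[nhds 0] fun _ => g 0 := by
    filter_upwards [hmax, hmin] with t ht ht'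
    exact le_antisymm ht ht'
  have heq2 := heq.deriv.deriv_eq
  rw [hd, h2.deriv] at heq2
  simp at heq2
  linarith

lemma hasDerivAt_finner_mul_transpose {m k : Type*} [Fintype m] [Fintype k] (A : Matrix m m ℝ)
    {X Y : ℝ → Matrix m k ℝ} {X' Y' : Matrix m k ℝ} {t : ℝ}
    (hX : ∀ q l, HasDerivAt (fun s => X s q l) (X' q l) t)
    (hY : ∀ q l, HasDerivAt (fun s => Y s q l) (Y' q l) t) :
    HasDerivAt (fun s => finner A (X s * (Y s)ᵀ))
      (finner A (X' * (Y t)ᵀ) + finner A (X t * Y'ᵀ)) t := by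
  have key : HasDerivAt (fun s => finner A (X s * (Y s)ᵀ))
      (∑ q, ∑ r, A q r * ∑ l, (X' q l * Y t r l + X t q l * Y' r l)) t := by
    simp only [finner, Matrix.mul_apply, Matrix.transpose_apply]
    refine HasDerivAt.fun_sum fun q _ => HasDerivAt.fun_sum fun r _ => ?_
    exact (HasDerivAt.fun_sum fun l _ => (hX q l).mul (hY r l)).const_mul _
  convert key using 1
  simp only [finner, Matrix.mul_apply, Matrix.transpose_apply, Finset.sum_add_distrib, mul_add]

section

attribute [local instance] Matrix.linftyOpNormedRing Matrix.linftyOpNormedAlgebra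

lemma hasDerivAt_mul_exp_smul_mul {m k l : Type*} [Fintype k] [DecidableEq k]
    (M : Matrix m k ℝ) (Ω : Matrix k k ℝ) (N : Matrix k l ℝ) (t : ℝ) (a : m) (b : l) :
    HasDerivAt (fun s : ℝ => (M * NormedSpace.exp (s • Ω) * N) a b)
      ((M * NormedSpace.exp (t • Ω) * (Ω * N)) a b) t := by
  have h := hasDerivAt_exp_smul_const (𝕂 := ℝ) Ω t
  have he : ∀ u v, HasDerivAt (fun s : ℝ => NormedSpace.exp (s • Ω) u v)
      ((NormedSpace.exp (t • Ω) * Ω) u v) t := fun u v =>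
    hasDerivAt_pi.1 (hasDerivAt_pi.1 h u) v
  have key : HasDerivAt (fun s : ℝ => ∑ v, (∑ u, M a u * NormedSpace.exp (s • Ω) u v) * N v b)
      (∑ v, (∑ u, M a u * (NormedSpace.exp (t • Ω) * Ω) u v) * N v b) t :=
    HasDerivAt.fun_sum fun v _ => (HasDerivAt.fun_sum fun u _ =>
      (he u v).const_mul _).mul_const _
  have e : M * NormedSpace.exp (t • Ω) * (Ω * N) = M * (NormedSpace.exp (t • Ω) * Ω) * N := by
    simp only [Matrix.mul_assoc]
  rw [e]
  simpa only [← Matrix.mul_apply] using key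

lemma exp_skew_mul_transpose {k : Type*} [Fintype k] [DecidableEq k] {Ω : Matrix k k ℝ}
    (hΩ : Ωᵀ = -Ω) (t : ℝ) :
    NormedSpace.exp (t • Ω) * (NormedSpace.exp (t • Ω))ᵀ = 1 := by
  have hc : Commute (t • Ω) (-(t • Ω)) := (Commute.refl (t • Ω)).neg_right
  rw [← Matrix.exp_transpose, Matrix.transpose_smul, hΩ, smul_neg,
    ← Matrix.exp_add_of_commute _ _ hc, add_neg_cancel, NormedSpace.exp_zero]

end

/-- The matrix with block rows `S_i N_i`. -/
def rowRightMul (S : Matrix (Fin n × Fin d) (Fin p) ℝ) (N : Fin n → Matrix (Fin p) (Fin p) ℝ) :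
    Matrix (Fin n × Fin d) (Fin p) ℝ := fun q => (rowBlk S q.1 * N q.1) q.2

lemma rowBlk_rowRightMul (S : Matrix (Fin n × Fin d) (Fin p) ℝ)
    (N : Fin n → Matrix (Fin p) (Fin p) ℝ) (i : Fin n) :
    rowBlk (rowRightMul S N) i = rowBlk S i * N i := rfl

lemma isLocalMax.rotation_conditions {A : Matrix (Fin n × Fin d) (Fin n × Fin d) ℝ}
    (hA : A.IsSymm) {S : Matrix (Fin n × Fin d) (Fin p) ℝ} (hS : isLocalMax A S)
    {Ω : Fin n → Matrix (Fin p) (Fin p) ℝ} (hΩ : ∀ i, (Ω i)ᵀ = -Ω i) :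
    finner (A * S) (rowRightMul S Ω) = 0 ∧
      finner A (rowRightMul S Ω * (rowRightMul S Ω)ᵀ) +
        finner (A * S) (rowRightMul S fun i => Ω i * Ω i) ≤ 0 := by
  obtain ⟨hSt, ε, hε, hmax⟩ := hS
  let γ : ℝ → Matrix (Fin n × Fin d) (Fin p) ℝ :=
    fun t => rowRightMul S fun i => NormedSpace.exp (t • Ω i)
  let γ1 : ℝ → Matrix (Fin n × Fin d) (Fin p) ℝ :=
    fun t => rowRightMul S fun i => NormedSpace.exp (t • Ω i) * Ω i
  let γ2 : ℝ → Matrix (Fin n × Fin d) (Fin p) ℝ :=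
    fun t => rowRightMul S fun i => NormedSpace.exp (t • Ω i) * (Ω i * Ω i)
  have hγ0 : γ 0 = S := by
    ext q l
    simp [γ, rowRightMul, rowBlk]
  have hγ10 : γ1 0 = rowRightMul S Ω := by
    ext q l
    simp [γ1, rowRightMul]
  have hγ20 : γ2 0 = rowRightMul S fun i => Ω i * Ω i := by
    ext q l
    simp [γ2, rowRightMul]
  have d1 : ∀ t q l, HasDerivAt (fun s => γ s q l) (γ1 t q l) t := fun t q l => by
    have := hasDerivAt_mul_exp_smul_mul (rowBlk S q.1) (Ω q.1) 1 t q.2 l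
    rw [Matrix.mul_one, Matrix.mul_assoc] at this
    simp only [Matrix.mul_one] at this
    exact this
  have d2 : ∀ t q l, HasDerivAt (fun s => γ1 s q l) (γ2 t q l) t := fun t q l => by
    have := hasDerivAt_mul_exp_smul_mul (rowBlk S q.1) (Ω q.1) (Ω q.1) t q.2 l
    simp only [Matrix.mul_assoc] at this
    exact this
  have hstief : ∀ t, StiefelBlocks (γ t) := fun t i => by
    rw [rowBlk_rowRightMul, Matrix.transpose_mul, Matrix.mul_assoc,
      ← Matrix.mul_assoc _ _ (rowBlk S i)ᵀ,
      exp_skew_mul_transpose (hΩ i), Matrix.one_mul, hSt i]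
  have hcont : ContinuousAt (fun t => frobNorm (γ t - S)) 0 := by
    unfold frobNorm
    refine ContinuousAt.sqrt ?_
    refine tendsto_finsetSum _ fun q _ => tendsto_finsetSum _ fun l _ => ?_
    exact (((d1 0 q l).continuousAt).sub continuousAt_const).pow 2
  have hlm : IsLocalMax (fun t => finner A (γ t * (γ t)ᵀ)) 0 := by
    have h0 : frobNorm (γ 0 - S) = 0 := by simp [hγ0, frobNorm]
    have : ∀ᶠ t in nhds (0 : ℝ), frobNorm (γ t - S) < ε :=
      hcont.eventually (gt_mem_nhds (h0.trans_lt hε))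
    filter_upwards [this] with t ht
    rw [hγ0]
    exact hmax _ (hstief t) ht
  have key := hlm.second_derivative_nonpos
    (fun t => hasDerivAt_finner_mul_transpose A (d1 t) (d1 t))
    ((hasDerivAt_finner_mul_transpose A (d2 0) (d1 0)).add
      (hasDerivAt_finner_mul_transpose A (d1 0) (d2 0)))
  rw [hγ0, hγ10, hγ20, finner_mul_transpose_comm hA S, finner_mul_transpose_comm hA S,
    finner_mul_transpose A _ S, finner_mul_transpose A _ S] at key
  constructor <;> linarith [key.1, key.2]

end Calculus

section CriticalPoints

variable {n d p : ℕ}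

lemma eq_zero_of_finner_self {m k : Type*} [Fintype m] [Fintype k] {X : Matrix m k ℝ}
    (h : finner X X = 0) : X = 0 := by
  ext i j
  have h1 := (Finset.sum_eq_zero_iff_of_nonneg fun i _ =>
    Finset.sum_nonneg fun j _ => mul_self_nonneg (X i j)).1 h i (Finset.mem_univ _)
  have h2 := (Finset.sum_eq_zero_iff_of_nonneg fun j _ => mul_self_nonneg (X i j)).1 h1 j
    (Finset.mem_univ _)
  simpa using h2

lemma finner_eq_sum_rowBlk (X Y : Matrix (Fin n × Fin d) (Fin p) ℝ) :
    finner X Y = ∑ i, finner (rowBlk X i) (rowBlk Y i) := by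
  simp only [finner, rowBlk, Fintype.sum_prod_type]

/-- The Lagrange multiplier `(A S)_i S_iᵀ` of the `i`-th Stiefel constraint. -/
def multiplier (A : Matrix (Fin n × Fin d) (Fin n × Fin d) ℝ)
    (S : Matrix (Fin n × Fin d) (Fin p) ℝ) (i : Fin n) : Matrix (Fin d) (Fin d) ℝ :=
  rowBlk (A * S) i * (rowBlk S i)ᵀ

lemma isLocalMax.transpose_mul_isSymm {A : Matrix (Fin n × Fin d) (Fin n × Fin d) ℝ}
    (hA : A.IsSymm) {S : Matrix (Fin n × Fin d) (Fin p) ℝ} (hS : isLocalMax A S) (i : Fin n) :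
    ((rowBlk S i)ᵀ * rowBlk (A * S) i)ᵀ = (rowBlk S i)ᵀ * rowBlk (A * S) i := by
  set M := (rowBlk S i)ᵀ * rowBlk (A * S) i with hM
  let Ω : Fin n → Matrix (Fin p) (Fin p) ℝ := fun j => if j = i then M - Mᵀ else 0
  have hΩ : ∀ j, (Ω j)ᵀ = -Ω j := fun j => by
    by_cases h : j = i <;> simp [Ω, h]
  have h1 := (hS.rotation_conditions hA hΩ).1
  rw [finner_eq_sum_rowBlk, Finset.sum_eq_single i] at h1
  · rw [rowBlk_rowRightMul] at h1
    simp only [Ω, if_true] at h1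
    rw [finner_eq_trace, Matrix.transpose_mul, ← Matrix.mul_assoc, Matrix.trace_mul_comm,
      ← Matrix.mul_assoc, ← hM] at h1
    have h2 : finner (M - Mᵀ) (M - Mᵀ) = 0 := by
      have e : (Mᵀ * (M - Mᵀ)ᵀ).trace = -(M * (M - Mᵀ)ᵀ).trace := by
        rw [← Matrix.trace_transpose, Matrix.transpose_mul, Matrix.transpose_transpose,
          Matrix.transpose_transpose, Matrix.trace_mul_comm, ← Matrix.trace_neg,
          ← Matrix.mul_neg]
        simp
      rw [finner_eq_trace, Matrix.sub_mul, Matrix.trace_sub, e, h1]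
      simp
    exact (sub_eq_zero.1 (eq_zero_of_finner_self h2)).symm
  · intro j _ hj
    rw [rowBlk_rowRightMul]
    simp [Ω, hj, finner]
  · simp

lemma isLocalMax.rowBlk_mul_eq {A : Matrix (Fin n × Fin d) (Fin n × Fin d) ℝ}
    (hA : A.IsSymm) {S : Matrix (Fin n × Fin d) (Fin p) ℝ} (hS : isLocalMax A S) (i : Fin n) :
    rowBlk (A * S) i = multiplier A S i * rowBlk S i ∧
      (multiplier A S i)ᵀ = multiplier A S i := by
  have h := hS.transpose_mul_isSymm hA i
  have hi := hS.1 i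
  have h1 : rowBlk (A * S) i = (multiplier A S i)ᵀ * rowBlk S i := by
    have := congrArg (fun M => rowBlk S i * M) h
    simp only [Matrix.transpose_mul, Matrix.transpose_transpose] at this
    rw [← Matrix.mul_assoc, ← Matrix.mul_assoc, hi, Matrix.one_mul] at this
    rw [← this, multiplier, Matrix.transpose_mul, Matrix.transpose_transpose]
  have h2 : (multiplier A S i)ᵀ = multiplier A S i := by
    conv_rhs => rw [multiplier, h1, Matrix.mul_assoc, hi, Matrix.mul_one]
  exact ⟨by rw [← h2]; exact h1, h2⟩

lemma isLocalMax.second_order {A : Matrix (Fin n × Fin d) (Fin n × Fin d) ℝ}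
    (hA : A.IsSymm) {S : Matrix (Fin n × Fin d) (Fin p) ℝ} (hS : isLocalMax A S)
    {Y : Matrix (Fin n × Fin d) (Fin p) ℝ} (hY : ∀ i, rowBlk S i * (rowBlk Y i)ᵀ = 0) :
    finner A (Y * Yᵀ) ≤ ∑ i, finner (multiplier A S i) (rowBlk Y i * (rowBlk Y i)ᵀ) := by
  let Ω : Fin n → Matrix (Fin p) (Fin p) ℝ :=
    fun i => (rowBlk S i)ᵀ * rowBlk Y i - (rowBlk Y i)ᵀ * rowBlk S i
  have hΩ : ∀ j, (Ω j)ᵀ = -Ω j := fun j => by simp [Ω]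
  have hY' : ∀ i, rowBlk Y i * (rowBlk S i)ᵀ = 0 := fun i => by
    rw [← Matrix.transpose_transpose (rowBlk Y i), ← Matrix.transpose_mul, hY,
      Matrix.transpose_zero]
  have e1 : ∀ i, rowBlk S i * Ω i = rowBlk Y i := fun i => by
    simp only [Ω, Matrix.mul_sub]
    rw [← Matrix.mul_assoc, ← Matrix.mul_assoc, hS.1 i, hY i]
    simp
  have e2 : ∀ i, rowBlk S i * (Ω i * Ω i) = -(rowBlk Y i * (rowBlk Y i)ᵀ * rowBlk S i) :=
    fun i => by
      rw [← Matrix.mul_assoc, e1]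
      simp only [Ω, Matrix.mul_sub]
      rw [← Matrix.mul_assoc, ← Matrix.mul_assoc, hY' i]
      simp
  have hrY : rowRightMul S Ω = Y := by
    ext q l
    exact congrFun (congrFun (e1 q.1) q.2) l
  have h2 := (hS.rotation_conditions hA hΩ).2
  rw [hrY, finner_eq_sum_rowBlk] at h2
  have e3 : ∀ i, finner (rowBlk (A * S) i) (rowBlk (rowRightMul S fun i => Ω i * Ω i) i) =
      -finner (multiplier A S i) (rowBlk Y i * (rowBlk Y i)ᵀ) := fun i => by
    rw [rowBlk_rowRightMul, e2, finner_eq_trace, finner_eq_trace, multiplier]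
    simp only [Matrix.transpose_neg, Matrix.transpose_mul, Matrix.transpose_transpose,
      Matrix.mul_neg, Matrix.trace_neg, Matrix.mul_assoc]
  simp only [e3, Finset.sum_neg_distrib] at h2
  linarith

/-- The `i`-th block of a stacked vector. -/
def vblk (x : Fin n × Fin d → ℝ) (i : Fin n) : Fin d → ℝ := fun k => x (i, k)

/-- The matrix whose row `(i, k)` is `x (i, k) • β i`. -/
def tensorRows (x : Fin n × Fin d → ℝ) (β : Fin n → Fin p → ℝ) :
    Matrix (Fin n × Fin d) (Fin p) ℝ := fun q l => x q * β q.1 l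

lemma isLocalMax.second_order_tensorRows {A : Matrix (Fin n × Fin d) (Fin n × Fin d) ℝ}
    (hA : A.IsSymm) {S : Matrix (Fin n × Fin d) (Fin p) ℝ} (hS : isLocalMax A S)
    (x : Fin n × Fin d → ℝ) {β : Fin n → Fin p → ℝ} (hβ : ∀ i, rowBlk S i *ᵥ β i = 0) :
    finner A (tensorRows x β * (tensorRows x β)ᵀ) ≤
      ∑ i, (β i ⬝ᵥ β i) * (vblk x i ⬝ᵥ multiplier A S i *ᵥ vblk x i) := by
  have hY : ∀ i, rowBlk S i * (rowBlk (tensorRows x β) i)ᵀ = 0 := fun i => by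
    ext k k'
    have := congrFun (hβ i) k
    simp only [Matrix.mulVec, dotProduct, Pi.zero_apply] at this
    simp only [Matrix.mul_apply, Matrix.transpose_apply, Matrix.zero_apply]
    calc _ = x (i, k') * ∑ l, rowBlk S i k l * β i l := by
          rw [Finset.mul_sum]
          exact Finset.sum_congr rfl fun l _ => by simp only [rowBlk, tensorRows]; ring
      _ = 0 := by rw [this, mul_zero]
  refine (hS.second_order hA hY).trans_eq (Finset.sum_congr rfl fun i _ => ?_)
  have e : ∀ k k', (rowBlk (tensorRows x β) i * (rowBlk (tensorRows x β) i)ᵀ) k k' =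
      x (i, k) * x (i, k') * (β i ⬝ᵥ β i) := by
    intro k k'
    simp only [Matrix.mul_apply, Matrix.transpose_apply, rowBlk, tensorRows, dotProduct,
      Finset.mul_sum]
    exact Finset.sum_congr rfl fun l _ => by ring
  simp only [finner, e]
  simp only [dotProduct, Matrix.mulVec, vblk]
  rw [Finset.mul_sum]
  refine Finset.sum_congr rfl fun k _ => ?_
  rw [Finset.mul_sum, Finset.mul_sum]
  refine Finset.sum_congr rfl fun k' _ => ?_
  ring

end CriticalPoints

section VectorNorm

/-- The Euclidean norm of a vector indexed by a finite type. -/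
def vnorm {ι : Type*} [Fintype ι] (x : ι → ℝ) : ℝ := Real.sqrt (x ⬝ᵥ x)

variable {ι κ : Type*} [Fintype ι] [Fintype κ]

lemma vnorm_eq_norm (x : ι → ℝ) : vnorm x = ‖WithLp.toLp 2 x‖ := by
  rw [EuclideanSpace.norm_eq, vnorm]
  congr 1
  exact Finset.sum_congr rfl fun i _ => by simp [sq]

lemma vnorm_nonneg (x : ι → ℝ) : 0 ≤ vnorm x := Real.sqrt_nonneg _

lemma dotProduct_self_nonneg' (x : ι → ℝ) : 0 ≤ x ⬝ᵥ x :=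
  Finset.sum_nonneg fun _ _ => mul_self_nonneg _

lemma vnorm_sq (x : ι → ℝ) : vnorm x ^ 2 = x ⬝ᵥ x := Real.sq_sqrt (dotProduct_self_nonneg' x)

lemma vnorm_add_le (x y : ι → ℝ) : vnorm (x + y) ≤ vnorm x + vnorm y := by
  simp only [vnorm_eq_norm, WithLp.toLp_add]
  exact norm_add_le _ _

lemma vnorm_neg (x : ι → ℝ) : vnorm (-x) = vnorm x := by
  simp [vnorm]

lemma vnorm_sum_le {τ : Type*} (s : Finset τ) (f : τ → ι → ℝ) :
    vnorm (∑ i ∈ s, f i) ≤ ∑ i ∈ s, vnorm (f i) := by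
  simp only [vnorm_eq_norm, WithLp.toLp_sum]
  exact norm_sum_le _ _

lemma eq_zero_of_vnorm {x : ι → ℝ} (h : vnorm x = 0) : x = 0 := by
  rw [vnorm_eq_norm, norm_eq_zero] at h
  simpa using h

lemma vnorm_smul (c : ℝ) (x : ι → ℝ) : vnorm (c • x) = |c| * vnorm x := by
  simp only [vnorm_eq_norm, WithLp.toLp_smul, norm_smul, Real.norm_eq_abs]

lemma dotProduct_le_vnorm (x y : ι → ℝ) : x ⬝ᵥ y ≤ vnorm x * vnorm y := by
  rw [vnorm_eq_norm, vnorm_eq_norm]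
  have := real_inner_le_norm (WithLp.toLp 2 x : EuclideanSpace ℝ ι) (WithLp.toLp 2 y)
  rw [EuclideanSpace.inner_eq_star_dotProduct] at this
  simpa [dotProduct_comm] using this

lemma vnorm_le_of_dotProduct_le {x : ι → ℝ} {c : ℝ} (hc : 0 ≤ c)
    (h : x ⬝ᵥ x ≤ c * vnorm x) : vnorm x ≤ c := by
  rw [← vnorm_sq] at h
  rcases (vnorm_nonneg x).eq_or_lt with h0 | h0
  · rwa [← h0]
  · nlinarith

lemma vnorm_transpose_mulVec {S : Matrix ι κ ℝ} [DecidableEq ι] (hS : S * Sᵀ = 1) (v : ι → ℝ) :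
    vnorm (Sᵀ *ᵥ v) = vnorm v := by
  unfold vnorm
  rw [Matrix.dotProduct_mulVec, Matrix.vecMul_transpose, Matrix.mulVec_mulVec, hS,
    Matrix.one_mulVec]

lemma frobNorm_nonneg (X : Matrix ι κ ℝ) : 0 ≤ frobNorm X := Real.sqrt_nonneg _

lemma frobNorm_sq (X : Matrix ι κ ℝ) : frobNorm X ^ 2 = finner X X := by
  have h : 0 ≤ ∑ i, ∑ j, (X i j) ^ 2 :=
    Finset.sum_nonneg fun _ _ => Finset.sum_nonneg fun _ _ => sq_nonneg _
  exact (Real.sq_sqrt h).trans (by simp [finner, sq])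

lemma finner_eq_dotProduct (X Y : Matrix ι κ ℝ) :
    finner X Y = (fun q : ι × κ => X q.1 q.2) ⬝ᵥ (fun q : ι × κ => Y q.1 q.2) := by
  simp only [finner, dotProduct, Fintype.sum_prod_type]

lemma frobNorm_eq_vnorm (X : Matrix ι κ ℝ) : frobNorm X = vnorm fun q : ι × κ => X q.1 q.2 := by
  rw [vnorm, ← finner_eq_dotProduct, ← frobNorm_sq, Real.sqrt_sq (frobNorm_nonneg X)]

lemma finner_le_frobNorm (X Y : Matrix ι κ ℝ) : finner X Y ≤ frobNorm X * frobNorm Y := by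
  rw [finner_eq_dotProduct, frobNorm_eq_vnorm, frobNorm_eq_vnorm]
  exact dotProduct_le_vnorm _ _

lemma finner_eq_sum_col (X Y : Matrix ι κ ℝ) : finner X Y = ∑ l, X.col l ⬝ᵥ Y.col l := by
  simp only [finner, dotProduct, Matrix.col]
  rw [Finset.sum_comm]
  rfl

lemma finner_transpose (X Y : Matrix ι κ ℝ) : finner Xᵀ Yᵀ = finner X Y := by
  simp only [finner, Matrix.transpose_apply]
  rw [Finset.sum_comm]

lemma finner_mul_transpose_self_eq_sum (M : Matrix ι ι ℝ) (Y : Matrix ι κ ℝ) :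
    finner M (Y * Yᵀ) = ∑ l, Y.col l ⬝ᵥ M *ᵥ Y.col l := by
  rw [finner_mul_transpose, finner_eq_sum_col]
  refine Finset.sum_congr rfl fun l _ => ?_
  rw [dotProduct_comm]
  congr 1

lemma finner_sub_self_le (X Y : Matrix ι κ ℝ) :
    finner (X - Y) (X - Y) ≤ 2 * finner X X + 2 * finner Y Y := by
  simp only [finner, Finset.mul_sum, ← Finset.sum_add_distrib]
  refine Finset.sum_le_sum fun i _ => Finset.sum_le_sum fun j _ => ?_
  simp only [Matrix.sub_apply]
  nlinarith [sq_nonneg (X i j + Y i j)]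

lemma vnorm_mulVec_le (X : Matrix ι κ ℝ) (v : κ → ℝ) :
    vnorm (X *ᵥ v) ≤ frobNorm X * vnorm v := by
  refine vnorm_le_of_dotProduct_le (mul_nonneg (frobNorm_nonneg _) (vnorm_nonneg _)) ?_
  have h : (X *ᵥ v) ⬝ᵥ (X *ᵥ v) = finner X (Matrix.vecMulVec (X *ᵥ v) v) := by
    simp only [finner, dotProduct, Matrix.vecMulVec_apply]
    refine Finset.sum_congr rfl fun i _ => ?_
    simp only [Matrix.mulVec, dotProduct]
    rw [Finset.mul_sum]
    exact Finset.sum_congr rfl fun j _ => by ring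
  have h2 : frobNorm (Matrix.vecMulVec (X *ᵥ v) v) = vnorm (X *ᵥ v) * vnorm v := by
    rw [vnorm, vnorm, ← Real.sqrt_mul (dotProduct_self_nonneg' _), frobNorm]
    congr 1
    simp only [dotProduct, Matrix.vecMulVec_apply, Finset.sum_mul_sum]
    exact Finset.sum_congr rfl fun i _ => Finset.sum_congr rfl fun j _ => by ring
  rw [h]
  refine (finner_le_frobNorm _ _).trans_eq ?_
  rw [h2]; ring

lemma frobNorm_transpose (X : Matrix ι κ ℝ) : frobNorm Xᵀ = frobNorm X := by
  rw [← sq_eq_sq₀ (frobNorm_nonneg _) (frobNorm_nonneg _), frobNorm_sq, frobNorm_sq,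
    finner_transpose]

lemma finner_self_mul_left {τ : Type*} [Fintype τ] [DecidableEq κ] {R : Matrix τ ι ℝ}
    [DecidableEq ι] (hR : Rᵀ * R = 1) (X : Matrix ι κ ℝ) :
    finner (R * X) (R * X) = finner X X := by
  rw [finner_eq_trace, finner_eq_trace, Matrix.transpose_mul, Matrix.trace_mul_comm,
    Matrix.mul_assoc, ← Matrix.mul_assoc Rᵀ, hR, Matrix.one_mul, Matrix.trace_mul_comm]

/-- A symmetric positive semidefinite matrix bounded below in norm is bounded below as a form. -/
lemma dotProduct_mulVec_ge_of_vnorm_ge [DecidableEq ι] {M : Matrix ι ι ℝ} (hM : Mᵀ = M)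
    (hpsd : ∀ v, 0 ≤ v ⬝ᵥ M *ᵥ v) {m : ℝ} (hm : ∀ v, m * vnorm v ≤ vnorm (M *ᵥ v)) (v : ι → ℝ) :
    m * (v ⬝ᵥ v) ≤ v ⬝ᵥ M *ᵥ v := by
  have hH : (M - m • (1 : Matrix ι ι ℝ)).IsHermitian := by
    rw [Matrix.IsHermitian, Matrix.conjTranspose_eq_transpose_of_trivial, Matrix.transpose_sub, hM,
      Matrix.transpose_smul, Matrix.transpose_one]
  have hps : (M - m • (1 : Matrix ι ι ℝ)).PosSemidef := by
    rw [hH.posSemidef_iff_eigenvalues_nonneg]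
    intro j
    set e : ι → ℝ := (hH.eigenvectorBasis j).ofLp with he
    have h1 := hH.mulVec_eigenvectorBasis j
    rw [← he] at h1
    have hn : vnorm e = 1 := by
      rw [vnorm_eq_norm]
      exact hH.eigenvectorBasis.orthonormal.1 j
    have h2 : M *ᵥ e = (hH.eigenvalues j + m) • e := by
      rw [Matrix.sub_mulVec, Matrix.smul_mulVec, Matrix.one_mulVec, sub_eq_iff_eq_add] at h1
      rw [h1, add_smul]
    have h3 := hpsd e
    have h4 := hm e
    rw [h2, dotProduct_smul, ← vnorm_sq, hn] at h3
    rw [h2, vnorm_smul, hn, mul_one, mul_one, abs_of_nonneg (by simpa using h3)] at h4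
    simpa using h4
  have := hps.dotProduct_mulVec_nonneg v
  simp only [star_trivial, Matrix.sub_mulVec, Matrix.smul_mulVec, Matrix.one_mulVec,
    dotProduct_sub, dotProduct_smul, smul_eq_mul] at this
  linarith

end VectorNorm

section BlockVectors

variable {n d p : ℕ}

/-- The stacked vector with `i`-th block `v` and all other blocks zero. -/
def blockSingle (i : Fin n) (v : Fin d → ℝ) : Fin n × Fin d → ℝ :=
  fun q => if q.1 = i then v q.2 else 0

lemma vblk_blockSingle (i j : Fin n) (v : Fin d → ℝ) :
    vblk (blockSingle i v) j = if j = i then v else 0 := by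
  ext k
  by_cases h : j = i <;> simp [vblk, blockSingle, h]

lemma dotProduct_eq_sum_vblk (x y : Fin n × Fin d → ℝ) :
    x ⬝ᵥ y = ∑ i, vblk x i ⬝ᵥ vblk y i := by
  simp only [dotProduct, vblk, Fintype.sum_prod_type]

lemma vblk_mulVec (M : Matrix (Fin n × Fin d) (Fin p) ℝ) (v : Fin p → ℝ) (i : Fin n) :
    vblk (M *ᵥ v) i = rowBlk M i *ᵥ v := rfl

lemma transpose_mulVec_eq_sum (M : Matrix (Fin n × Fin d) (Fin p) ℝ) (x : Fin n × Fin d → ℝ) :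
    Mᵀ *ᵥ x = ∑ i, (rowBlk M i)ᵀ *ᵥ vblk x i := by
  ext l
  simp only [Matrix.mulVec, dotProduct, Matrix.transpose_apply, Finset.sum_apply, vblk, rowBlk,
    Fintype.sum_prod_type]

lemma transpose_mulVec_blockSingle (M : Matrix (Fin n × Fin d) (Fin p) ℝ) (i : Fin n)
    (v : Fin d → ℝ) : Mᵀ *ᵥ blockSingle i v = (rowBlk M i)ᵀ *ᵥ v := by
  rw [transpose_mulVec_eq_sum, Finset.sum_eq_single i]
  · simp [vblk_blockSingle]
  · intro j _ hj
    simp [vblk_blockSingle, hj]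
  · simp

lemma blockSingle_dotProduct (i : Fin n) (v : Fin d → ℝ) (x : Fin n × Fin d → ℝ) :
    blockSingle i v ⬝ᵥ x = v ⬝ᵥ vblk x i := by
  rw [dotProduct_eq_sum_vblk, Finset.sum_eq_single i]
  · simp [vblk_blockSingle]
  · intro j _ hj
    simp [vblk_blockSingle, hj]
  · simp

lemma vnorm_blockSingle (i : Fin n) (v : Fin d → ℝ) : vnorm (blockSingle i v) = vnorm v := by
  rw [vnorm, blockSingle_dotProduct, vblk_blockSingle, if_pos rfl, vnorm]

lemma dotProduct_transpose_mulVec_eq {ι κ : Type*} [Fintype ι] [Fintype κ] (M : Matrix ι κ ℝ)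
    (x : κ → ℝ) (y : ι → ℝ) : x ⬝ᵥ Mᵀ *ᵥ y = (M *ᵥ x) ⬝ᵥ y := by
  rw [Matrix.dotProduct_mulVec, Matrix.vecMul_transpose]

lemma dotProduct_mul_transpose_mulVec {ι κ : Type*} [Fintype ι] [Fintype κ] (M : Matrix ι κ ℝ)
    (x : ι → ℝ) : x ⬝ᵥ (M * Mᵀ) *ᵥ x = (Mᵀ *ᵥ x) ⬝ᵥ (Mᵀ *ᵥ x) := by
  rw [← Matrix.mulVec_mulVec, Matrix.dotProduct_mulVec, ← Matrix.mulVec_transpose]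

lemma blockSingle_dotProduct_mulVec_blockSingle
    {M : Matrix (Fin n × Fin d) (Fin n × Fin d) ℝ} {i : Fin n} (hM : blk M i i = 0)
    (v : Fin d → ℝ) : blockSingle i v ⬝ᵥ M *ᵥ blockSingle i v = 0 := by
  rw [blockSingle_dotProduct]
  have : vblk (M *ᵥ blockSingle i v) i = blk M i i *ᵥ v := by
    ext k
    simp only [vblk, Matrix.mulVec, dotProduct, blk, blockSingle, Fintype.sum_prod_type]
    rw [Finset.sum_eq_single i]
    · simp
    · intro j _ hj
      simp [hj]
    · simp
  rw [this, hM, Matrix.zero_mulVec, dotProduct_zero]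

lemma StiefelBlocks.vnorm_transpose_mulVec {S : Matrix (Fin n × Fin d) (Fin p) ℝ}
    (hS : StiefelBlocks S) (i : Fin n) (v : Fin d → ℝ) :
    vnorm ((rowBlk S i)ᵀ *ᵥ v) = vnorm v := _root_.vnorm_transpose_mulVec (hS i) v

lemma StiefelBlocks.transpose_mul_self {G : Matrix (Fin n × Fin d) (Fin d) ℝ}
    (hG : StiefelBlocks G) (i : Fin n) : (rowBlk G i)ᵀ * rowBlk G i = 1 :=
  mul_eq_one_comm.1 (hG i)

lemma StiefelBlocks.vnorm_rowBlk_mulVec {G : Matrix (Fin n × Fin d) (Fin d) ℝ}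
    (hG : StiefelBlocks G) (i : Fin n) (v : Fin d → ℝ) :
    vnorm (rowBlk G i *ᵥ v) = vnorm v := by
  have := _root_.vnorm_transpose_mulVec (S := (rowBlk G i)ᵀ)
    (by rw [Matrix.transpose_transpose]; exact hG.transpose_mul_self i) v
  rwa [Matrix.transpose_transpose] at this

lemma StiefelBlocks.exists_mulVec {G : Matrix (Fin n × Fin d) (Fin d) ℝ}
    (hG : StiefelBlocks G) (i : Fin n) (v : Fin d → ℝ) :
    ∃ a, rowBlk G i *ᵥ a = v ∧ vnorm a = vnorm v :=
  ⟨(rowBlk G i)ᵀ *ᵥ v, by rw [Matrix.mulVec_mulVec, hG i, Matrix.one_mulVec],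
    hG.vnorm_transpose_mulVec i v⟩

lemma isSymm_mul_transpose_add {ι κ : Type*} [Fintype κ] (G : Matrix ι κ ℝ) {Δ : Matrix ι ι ℝ}
    (hΔ : Δ.IsSymm) : (G * Gᵀ + Δ).IsSymm := by
  rw [Matrix.IsSymm, Matrix.transpose_add, Matrix.transpose_mul, Matrix.transpose_transpose, hΔ]

lemma isLocalMax.multiplier_nonneg {G : Matrix (Fin n × Fin d) (Fin d) ℝ}
    {Δ : Matrix (Fin n × Fin d) (Fin n × Fin d) ℝ} (hΔ : Δ.IsSymm) (hΔ0 : ∀ i, blk Δ i i = 0)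
    (hdp : d < p) {S : Matrix (Fin n × Fin d) (Fin p) ℝ} (hS : isLocalMax (G * Gᵀ + Δ) S)
    (i : Fin n) (v : Fin d → ℝ) : 0 ≤ v ⬝ᵥ multiplier (G * Gᵀ + Δ) S i *ᵥ v := by
  have hA : (G * Gᵀ + Δ).IsSymm := isSymm_mul_transpose_add G hΔ
  obtain ⟨b, hb, hb0⟩ : ∃ b, rowBlk S i *ᵥ b = 0 ∧ b ≠ 0 := by
    have hker : LinearMap.ker (Matrix.mulVecLin (rowBlk S i)) ≠ ⊥ :=
      LinearMap.ker_ne_bot_of_finrank_lt (by simpa using hdp)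
    obtain ⟨b, hb, hb0⟩ := Submodule.exists_mem_ne_zero_of_ne_bot hker
    exact ⟨b, by simpa using hb, hb0⟩
  have hbpos : 0 < b ⬝ᵥ b :=
    lt_of_le_of_ne (dotProduct_self_nonneg' b) fun h => hb0 (dotProduct_self_eq_zero.1 h.symm)
  have h := hS.second_order_tensorRows hA (blockSingle i v)
    (β := fun j => if j = i then b else 0) fun j => by
      by_cases h : j = i
      · subst h; simpa using hb
      · simp [h]
  rw [finner_mul_transpose_self_eq_sum, Finset.sum_eq_single i] at h
  · simp only [if_true, vblk_blockSingle] at h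
    have e : ∀ l, (tensorRows (blockSingle i v) fun j => if j = i then b else 0).col l =
        b l • blockSingle i v := fun l => by
      ext q
      by_cases hq : q.1 = i <;> simp [tensorRows, blockSingle, hq, mul_comm]
    have h0 : 0 ≤ ∑ l, b l • blockSingle i v ⬝ᵥ (G * Gᵀ + Δ) *ᵥ (b l • blockSingle i v) := by
      refine Finset.sum_nonneg fun l _ => ?_
      rw [Matrix.mulVec_smul, smul_dotProduct, dotProduct_smul, Matrix.add_mulVec,
        dotProduct_add, blockSingle_dotProduct_mulVec_blockSingle (hΔ0 i),
        dotProduct_mul_transpose_mulVec, add_zero, smul_eq_mul, smul_eq_mul, ← mul_assoc]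
      exact mul_nonneg (mul_self_nonneg _) (dotProduct_self_nonneg' _)
    simp only [e] at h
    exact nonneg_of_mul_nonneg_right (h0.trans h) hbpos
  · intro j _ hj
    simp [hj]
  · simp

end BlockVectors

section AverageMultiplier

variable {n d p : ℕ}

lemma sq_trace_le_card_mul_finner {κ : Type*} [Fintype κ] (M : Matrix κ κ ℝ) :
    M.trace ^ 2 ≤ Fintype.card κ * finner M M := by
  have h1 : M.trace ^ 2 ≤ Fintype.card κ * ∑ k, M k k ^ 2 := by
    simpa [Matrix.trace] using sq_sum_le_card_mul_sum_sq (s := Finset.univ) (f := fun k => M k k)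
  refine h1.trans (mul_le_mul_of_nonneg_left (Finset.sum_le_sum fun k _ => ?_) (by positivity))
  calc M k k ^ 2 = M k k * M k k := sq _
    _ ≤ ∑ l, M k l * M k l :=
      Finset.single_le_sum (f := fun l => M k l * M k l) (fun l _ => mul_self_nonneg _)
        (Finset.mem_univ k)

/-- The orthogonal projection onto the kernel of `S`. -/
def kerProj (S : Matrix (Fin d) (Fin p) ℝ) : Matrix (Fin p) (Fin p) ℝ := 1 - Sᵀ * S

lemma mul_kerProj {S : Matrix (Fin d) (Fin p) ℝ} (hS : S * Sᵀ = 1) : S * kerProj S = 0 := by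
  rw [kerProj, Matrix.mul_sub, ← Matrix.mul_assoc, hS, Matrix.mul_one, Matrix.one_mul, sub_self]

lemma transpose_kerProj (S : Matrix (Fin d) (Fin p) ℝ) : (kerProj S)ᵀ = kerProj S := by
  simp [kerProj]

lemma kerProj_mul_self {S : Matrix (Fin d) (Fin p) ℝ} (hS : S * Sᵀ = 1) :
    kerProj S * kerProj S = kerProj S := by
  conv_lhs => rw [kerProj, Matrix.sub_mul, Matrix.mul_assoc]
  rw [← kerProj, mul_kerProj hS]
  simp

lemma trace_kerProj {S : Matrix (Fin d) (Fin p) ℝ} (hS : S * Sᵀ = 1) :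
    (kerProj S).trace = p - d := by
  rw [kerProj, Matrix.trace_sub, Matrix.trace_mul_comm, hS]
  simp

lemma finner_kerProj_self {S : Matrix (Fin d) (Fin p) ℝ} (hS : S * Sᵀ = 1) :
    finner (kerProj S) (kerProj S) = p - d := by
  rw [finner_eq_trace, transpose_kerProj, kerProj_mul_self hS, trace_kerProj hS]

lemma neg_le_dotProduct_mulVec {ι : Type*} [Fintype ι] {Δ : Matrix ι ι ℝ} {δ : ℝ}
    (h : ∀ x y, x ⬝ᵥ Δ *ᵥ y ≤ δ * vnorm x * vnorm y) (x : ι → ℝ) :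
    -(δ * (x ⬝ᵥ x)) ≤ x ⬝ᵥ Δ *ᵥ x := by
  have := h (-x) x
  rw [neg_dotProduct, vnorm_neg, mul_assoc, ← sq, vnorm_sq] at this
  linarith

lemma finner_tensorRows_self (x : Fin n × Fin d → ℝ) (β : Fin n → Fin p → ℝ) :
    finner (tensorRows x β) (tensorRows x β) =
      ∑ i, (vblk x i ⬝ᵥ vblk x i) * (β i ⬝ᵥ β i) := by
  simp only [finner, tensorRows, vblk, dotProduct, Fintype.sum_prod_type, Finset.sum_mul_sum]
  exact Finset.sum_congr rfl fun i _ => Finset.sum_congr rfl fun k _ =>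
    Finset.sum_congr rfl fun l _ => by ring

lemma transpose_mul_tensorRows {G : Matrix (Fin n × Fin d) (Fin d) ℝ} (hG : StiefelBlocks G)
    (a : Fin d → ℝ) (β : Fin n → Fin p → ℝ) :
    Gᵀ * tensorRows (G *ᵥ a) β = Matrix.vecMulVec a (∑ i, β i) := by
  ext k l
  have h : ∀ i, ∑ k', G (i, k') k * (G *ᵥ a) (i, k') = a k := fun i => by
    have := congrFun (congrArg (fun M => M *ᵥ a) (hG.transpose_mul_self i)) k
    simp only [← Matrix.mulVec_mulVec, Matrix.one_mulVec] at this
    exact this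
  simp only [Matrix.mul_apply, Matrix.transpose_apply, tensorRows, Fintype.sum_prod_type,
    Matrix.vecMulVec_apply, Finset.sum_apply, Finset.mul_sum]
  refine Finset.sum_congr rfl fun i _ => ?_
  rw [← h i, Finset.sum_mul]
  exact Finset.sum_congr rfl fun k' _ => by ring

lemma finner_vecMulVec_self {ι κ : Type*} [Fintype ι] [Fintype κ] (a : ι → ℝ) (b : κ → ℝ) :
    finner (Matrix.vecMulVec a b) (Matrix.vecMulVec a b) = (a ⬝ᵥ a) * (b ⬝ᵥ b) := by
  simp only [finner, dotProduct, Matrix.vecMulVec_apply, Finset.sum_mul_sum]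
  exact Finset.sum_congr rfl fun i _ => Finset.sum_congr rfl fun j _ => by ring

lemma isLocalMax.sum_multiplier_ge {G : Matrix (Fin n × Fin d) (Fin d) ℝ} (hG : StiefelBlocks G)
    {Δ : Matrix (Fin n × Fin d) (Fin n × Fin d) ℝ} (hΔ : Δ.IsSymm) {δ : ℝ}
    (hδ : ∀ x y, x ⬝ᵥ Δ *ᵥ y ≤ δ * vnorm x * vnorm y) (hdp : 2 * d < p)
    {S : Matrix (Fin n × Fin d) (Fin p) ℝ} (hS : isLocalMax (G * Gᵀ + Δ) S) (a : Fin d → ℝ) :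
    ((n : ℝ) ^ 2 / 2 - δ * n) * (a ⬝ᵥ a) ≤
      ∑ i, (rowBlk G i *ᵥ a) ⬝ᵥ multiplier (G * Gᵀ + Δ) S i *ᵥ (rowBlk G i *ᵥ a) := by
  have hA : (G * Gᵀ + Δ).IsSymm := isSymm_mul_transpose_add G hΔ
  set P : Fin n → Matrix (Fin p) (Fin p) ℝ := fun i => kerProj (rowBlk S i) with hP
  set f : Fin n → ℝ :=
    fun i => (rowBlk G i *ᵥ a) ⬝ᵥ multiplier (G * Gᵀ + Δ) S i *ᵥ (rowBlk G i *ᵥ a) with hf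
  have hPd : ∀ i, ∑ l, (P i).col l ⬝ᵥ (P i).col l = (p : ℝ) - d := fun i => by
    rw [← finner_eq_sum_col, finner_kerProj_self (hS.1 i)]
  have haa : ∀ i, vblk (G *ᵥ a) i ⬝ᵥ vblk (G *ᵥ a) i = a ⬝ᵥ a := fun i => by
    rw [vblk_mulVec, ← vnorm_sq, hG.vnorm_rowBlk_mulVec, vnorm_sq]
  have hl : ∀ l, (a ⬝ᵥ a) * ((∑ i, (P i).col l) ⬝ᵥ (∑ i, (P i).col l)) -
      δ * ((a ⬝ᵥ a) * ∑ i, (P i).col l ⬝ᵥ (P i).col l) ≤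
      ∑ i, ((P i).col l ⬝ᵥ (P i).col l) * f i := fun l => by
    have h := hS.second_order_tensorRows hA (G *ᵥ a) (β := fun i => (P i).col l) fun i => by
      ext k
      exact congrFun (congrFun (mul_kerProj (hS.1 i)) k) l
    refine le_trans ?_ h
    set Y := tensorRows (G *ᵥ a) fun i => (P i).col l with hY
    have h1 : finner (G * Gᵀ + Δ) (Y * Yᵀ) = finner (G * Gᵀ) (Y * Yᵀ) + finner Δ (Y * Yᵀ) := by
      simp only [finner, Matrix.add_apply, add_mul, Finset.sum_add_distrib]
    have h2 : finner (G * Gᵀ) (Y * Yᵀ) = finner (Gᵀ * Y) (Gᵀ * Y) := by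
      rw [finner_mul_transpose_self_eq_sum, finner_eq_sum_col]
      exact Finset.sum_congr rfl fun l _ => dotProduct_mul_transpose_mulVec G _
    have h3 : -(δ * finner Y Y) ≤ finner Δ (Y * Yᵀ) := by
      rw [finner_mul_transpose_self_eq_sum, finner_eq_sum_col, Finset.mul_sum,
        ← Finset.sum_neg_distrib]
      exact Finset.sum_le_sum fun l _ => neg_le_dotProduct_mulVec hδ _
    rw [finner_tensorRows_self] at h3
    simp only [haa, ← Finset.mul_sum] at h3
    rw [h1, h2, hY, transpose_mul_tensorRows hG, finner_vecMulVec_self]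
    linarith
  have hsum := Finset.sum_le_sum fun l (_ : l ∈ Finset.univ) => hl l
  rw [Finset.sum_sub_distrib, ← Finset.mul_sum, ← Finset.mul_sum, ← Finset.mul_sum,
    Finset.sum_comm, Finset.sum_comm (f := fun l i => ((P i).col l ⬝ᵥ (P i).col l) * f i)] at hsum
  simp only [hPd, ← Finset.sum_mul] at hsum
  rw [Finset.sum_const, ← Finset.mul_sum, Finset.card_univ, Fintype.card_fin, nsmul_eq_mul] at hsum
  have htr : (∑ i, P i).trace = n * ((p : ℝ) - d) := by
    rw [Matrix.trace_sum]
    simp only [hP, trace_kerProj (hS.1 _)]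
    rw [Finset.sum_const, Finset.card_univ, Fintype.card_fin, nsmul_eq_mul]
  have hcs := sq_trace_le_card_mul_finner (∑ i, P i)
  have hcol : ∀ l, (∑ i, P i).col l = ∑ i, (P i).col l := fun l => by
    ext k
    simp [Matrix.sum_apply]
  rw [htr, Fintype.card_fin, finner_eq_sum_col] at hcs
  simp only [hcol] at hcs
  set T := ∑ l, (∑ i, (P i).col l) ⬝ᵥ (∑ i, (P i).col l)
  have hdp' : 2 * (d : ℝ) < p := by exact_mod_cast hdp
  have hq : 0 < (p : ℝ) - d := by have : (0 : ℝ) ≤ d := d.cast_nonneg; linarith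
  have hp : 0 < (p : ℝ) := by have : (0 : ℝ) ≤ d := d.cast_nonneg; linarith
  have hT : (n : ℝ) ^ 2 / 2 * (p - d) ≤ T := by
    have : (p : ℝ) * ((n : ℝ) ^ 2 / 2 * (p - d)) ≤ p * T := by
      refine le_trans ?_ hcs
      have : 0 ≤ (n : ℝ) ^ 2 * (p - d) * (p - 2 * d) :=
        mul_nonneg (by positivity) (by linarith)
      nlinarith
    exact le_of_mul_le_mul_left this hp
  have := mul_le_mul_of_nonneg_left hT (dotProduct_self_nonneg' a)
  refine le_of_mul_le_mul_left ?_ hq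
  linarith

end AverageMultiplier

section NoiseControl

variable {n d p : ℕ}

/-- The action of the adjoint of the `i`-th block row of `Δ S` on `G_i a`. -/
def noiseVec (G : Matrix (Fin n × Fin d) (Fin d) ℝ)
    (Δ : Matrix (Fin n × Fin d) (Fin n × Fin d) ℝ) (S : Matrix (Fin n × Fin d) (Fin p) ℝ)
    (i : Fin n) (a : Fin d → ℝ) : Fin p → ℝ :=
  (rowBlk (Δ * S) i)ᵀ *ᵥ (rowBlk G i *ᵥ a)

lemma rowBlk_mul_transpose_add_mul (G : Matrix (Fin n × Fin d) (Fin d) ℝ)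
    (Δ : Matrix (Fin n × Fin d) (Fin n × Fin d) ℝ) (S : Matrix (Fin n × Fin d) (Fin p) ℝ)
    (i : Fin n) :
    rowBlk ((G * Gᵀ + Δ) * S) i = rowBlk G i * (Gᵀ * S) + rowBlk (Δ * S) i := by
  rw [Matrix.add_mul, Matrix.mul_assoc]
  rfl

lemma isLocalMax.vnorm_multiplier_mulVec {G : Matrix (Fin n × Fin d) (Fin d) ℝ}
    (hG : StiefelBlocks G) {Δ : Matrix (Fin n × Fin d) (Fin n × Fin d) ℝ} (hΔ : Δ.IsSymm)
    {S : Matrix (Fin n × Fin d) (Fin p) ℝ} (hS : isLocalMax (G * Gᵀ + Δ) S) (i : Fin n)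
    (a : Fin d → ℝ) :
    vnorm (multiplier (G * Gᵀ + Δ) S i *ᵥ (rowBlk G i *ᵥ a)) =
      vnorm ((Gᵀ * S)ᵀ *ᵥ a + noiseVec G Δ S i a) := by
  obtain ⟨h1, h2⟩ := hS.rowBlk_mul_eq (isSymm_mul_transpose_add G hΔ) i
  rw [← hS.1.vnorm_transpose_mulVec i, Matrix.mulVec_mulVec]
  nth_rewrite 1 [← h2]
  rw [← Matrix.transpose_mul, ← h1, rowBlk_mul_transpose_add_mul, Matrix.transpose_add,
    Matrix.add_mulVec, Matrix.transpose_mul, ← Matrix.mulVec_mulVec,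
    Matrix.mulVec_mulVec _ (rowBlk G i)ᵀ, hG.transpose_mul_self, Matrix.one_mulVec]
  rfl

lemma isLocalMax.mul_vnorm_multiplier_ge {G : Matrix (Fin n × Fin d) (Fin d) ℝ}
    (hG : StiefelBlocks G) {Δ : Matrix (Fin n × Fin d) (Fin n × Fin d) ℝ} (hΔ : Δ.IsSymm) {δ : ℝ}
    (hδ : ∀ x y, x ⬝ᵥ Δ *ᵥ y ≤ δ * vnorm x * vnorm y) (hdp : 2 * d < p)
    {S : Matrix (Fin n × Fin d) (Fin p) ℝ} (hS : isLocalMax (G * Gᵀ + Δ) S) (i : Fin n)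
    (a : Fin d → ℝ) :
    ((n : ℝ) ^ 2 / 2 - δ * n) * vnorm a ≤
      n * vnorm (multiplier (G * Gᵀ + Δ) S i *ᵥ (rowBlk G i *ᵥ a)) +
        n * vnorm (noiseVec G Δ S i a) + ∑ j, vnorm (noiseVec G Δ S j a) := by
  rcases (vnorm_nonneg a).eq_or_lt with h0 | h0
  · rw [← h0, mul_zero]
    exact add_nonneg (add_nonneg (mul_nonneg n.cast_nonneg (vnorm_nonneg _))
      (mul_nonneg n.cast_nonneg (vnorm_nonneg _))) (Finset.sum_nonneg fun _ _ => vnorm_nonneg _)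
  have h := hS.sum_multiplier_ge hG hΔ hδ hdp a
  have hj : ∀ j, (rowBlk G j *ᵥ a) ⬝ᵥ multiplier (G * Gᵀ + Δ) S j *ᵥ (rowBlk G j *ᵥ a) ≤
      vnorm a * (vnorm (multiplier (G * Gᵀ + Δ) S i *ᵥ (rowBlk G i *ᵥ a)) +
        vnorm (noiseVec G Δ S i a) + vnorm (noiseVec G Δ S j a)) := fun j => by
    refine (dotProduct_le_vnorm _ _).trans ?_
    rw [hG.vnorm_rowBlk_mulVec, hS.vnorm_multiplier_mulVec hG hΔ j,
      hS.vnorm_multiplier_mulVec hG hΔ i]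
    refine mul_le_mul_of_nonneg_left ?_ (vnorm_nonneg _)
    have e : (Gᵀ * S)ᵀ *ᵥ a + noiseVec G Δ S j a =
        ((Gᵀ * S)ᵀ *ᵥ a + noiseVec G Δ S i a) + -noiseVec G Δ S i a + noiseVec G Δ S j a := by
      abel
    rw [e]
    refine (vnorm_add_le _ _).trans (add_le_add ((vnorm_add_le _ _).trans ?_) le_rfl)
    rw [vnorm_neg]
  have h2 := h.trans (Finset.sum_le_sum fun j _ => hj j)
  rw [← Finset.mul_sum, Finset.sum_add_distrib, Finset.sum_const, Finset.card_univ,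
    Fintype.card_fin, nsmul_eq_mul, ← vnorm_sq] at h2
  refine le_of_mul_le_mul_left ?_ h0
  linarith

lemma isLocalMax.multiplier_ge {G : Matrix (Fin n × Fin d) (Fin d) ℝ}
    (hG : StiefelBlocks G) {Δ : Matrix (Fin n × Fin d) (Fin n × Fin d) ℝ} (hΔ : Δ.IsSymm)
    (hΔ0 : ∀ i, blk Δ i i = 0) {δ : ℝ}
    (hδ : ∀ x y, x ⬝ᵥ Δ *ᵥ y ≤ δ * vnorm x * vnorm y) (hdp : 2 * d < p)
    {S : Matrix (Fin n × Fin d) (Fin p) ℝ} (hS : isLocalMax (G * Gᵀ + Δ) S) (i : Fin n) {η : ℝ}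
    (hi : ∀ a, vnorm (noiseVec G Δ S i a) ≤ η * vnorm a)
    (hsum : ∀ a, ∑ j, vnorm (noiseVec G Δ S j a) ≤ n * η * vnorm a) (v : Fin d → ℝ) :
    ((n : ℝ) / 2 - δ - 2 * η) * (v ⬝ᵥ v) ≤ v ⬝ᵥ multiplier (G * Gᵀ + Δ) S i *ᵥ v := by
  refine dotProduct_mulVec_ge_of_vnorm_ge
    (hS.rowBlk_mul_eq (isSymm_mul_transpose_add G hΔ) i).2
    (hS.multiplier_nonneg hΔ hΔ0 (by omega) i) (fun v => ?_) v
  obtain ⟨a, rfl, ha⟩ := hG.exists_mulVec i v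
  rw [← ha]
  have hn : (0 : ℝ) < n := by exact_mod_cast Nat.zero_lt_of_lt i.2
  have h := hS.mul_vnorm_multiplier_ge hG hΔ hδ hdp i a
  have h1 := mul_le_mul_of_nonneg_left (hi a) hn.le
  have h2 := hsum a
  refine le_of_mul_le_mul_left ?_ hn
  linarith

lemma vnorm_mulVec_le_of_form {ι : Type*} [Fintype ι] {Δ : Matrix ι ι ℝ} {δ : ℝ} (hδ0 : 0 ≤ δ)
    (hδ : ∀ x y, x ⬝ᵥ Δ *ᵥ y ≤ δ * vnorm x * vnorm y) (x : ι → ℝ) :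
    vnorm (Δ *ᵥ x) ≤ δ * vnorm x := by
  refine vnorm_le_of_dotProduct_le (mul_nonneg hδ0 (vnorm_nonneg _)) ((hδ _ _).trans_eq (by ring))

lemma noiseVec_eq {G : Matrix (Fin n × Fin d) (Fin d) ℝ}
    {Δ : Matrix (Fin n × Fin d) (Fin n × Fin d) ℝ} (hΔ : Δ.IsSymm)
    (S : Matrix (Fin n × Fin d) (Fin p) ℝ) (i : Fin n) (a : Fin d → ℝ) :
    noiseVec G Δ S i a = Sᵀ *ᵥ (Δ *ᵥ blockSingle i (rowBlk G i *ᵥ a)) := by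
  rw [noiseVec, ← transpose_mulVec_blockSingle, Matrix.transpose_mul, hΔ, Matrix.mulVec_mulVec]

lemma StiefelBlocks.vnorm_transpose_mulVec_le {S : Matrix (Fin n × Fin d) (Fin p) ℝ}
    (hS : StiefelBlocks S) (x : Fin n × Fin d → ℝ) :
    vnorm (Sᵀ *ᵥ x) ≤ Real.sqrt n * vnorm x := by
  rw [transpose_mulVec_eq_sum]
  refine (vnorm_sum_le _ _).trans ?_
  simp only [hS.vnorm_transpose_mulVec]
  rw [vnorm, ← Real.sqrt_mul n.cast_nonneg]
  refine Real.le_sqrt_of_sq_le ?_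
  have := sq_sum_le_card_mul_sum_sq (s := Finset.univ) (f := fun i => vnorm (vblk x i))
  rw [Finset.card_univ, Fintype.card_fin] at this
  simp only [vnorm_sq] at this
  rwa [dotProduct_eq_sum_vblk]

lemma vnorm_noiseVec_le_of_sqrt {G : Matrix (Fin n × Fin d) (Fin d) ℝ} (hG : StiefelBlocks G)
    {Δ : Matrix (Fin n × Fin d) (Fin n × Fin d) ℝ} (hΔ : Δ.IsSymm) {δ : ℝ} (hδ0 : 0 ≤ δ)
    (hδ : ∀ x y, x ⬝ᵥ Δ *ᵥ y ≤ δ * vnorm x * vnorm y)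
    {S : Matrix (Fin n × Fin d) (Fin p) ℝ} (hS : StiefelBlocks S) (i : Fin n) (a : Fin d → ℝ) :
    vnorm (noiseVec G Δ S i a) ≤ Real.sqrt n * δ * vnorm a := by
  rw [noiseVec_eq hΔ, mul_assoc]
  refine (hS.vnorm_transpose_mulVec_le _).trans
    (mul_le_mul_of_nonneg_left ?_ (Real.sqrt_nonneg _))
  refine (vnorm_mulVec_le_of_form hδ0 hδ _).trans_eq ?_
  rw [vnorm_blockSingle, hG.vnorm_rowBlk_mulVec]

lemma StiefelBlocks.finner_self {S : Matrix (Fin n × Fin d) (Fin p) ℝ} (hS : StiefelBlocks S) :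
    finner S S = n * d := by
  rw [finner_eq_sum_rowBlk]
  simp only [finner_eq_trace, hS _, Matrix.trace_one, Fintype.card_fin]
  rw [Finset.sum_const, Finset.card_univ, Fintype.card_fin, nsmul_eq_mul]

lemma finner_mul_self_le {ι κ : Type*} [Fintype ι] [Fintype κ] {Δ : Matrix ι ι ℝ} {δ : ℝ}
    (hδ0 : 0 ≤ δ) (hδ : ∀ x y, x ⬝ᵥ Δ *ᵥ y ≤ δ * vnorm x * vnorm y) (S : Matrix ι κ ℝ) :
    finner (Δ * S) (Δ * S) ≤ δ ^ 2 * finner S S := by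
  rw [finner_eq_sum_col, finner_eq_sum_col, Finset.mul_sum]
  refine Finset.sum_le_sum fun l _ => ?_
  have e : (Δ * S).col l = Δ *ᵥ S.col l := rfl
  rw [e, ← vnorm_sq, ← vnorm_sq, ← mul_pow]
  exact pow_le_pow_left₀ (vnorm_nonneg _) (vnorm_mulVec_le_of_form hδ0 hδ _) 2

lemma finner_mul_self_ge {ι κ : Type*} [Fintype ι] [Fintype κ] {H : Matrix ι ι ℝ} {m : ℝ}
    (hm : ∀ v, m * (v ⬝ᵥ v) ≤ v ⬝ᵥ H *ᵥ v) (E : Matrix ι κ ℝ) :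
    m * finner E E ≤ finner (H * E) E := by
  rw [finner_eq_sum_col, finner_eq_sum_col, Finset.mul_sum]
  refine Finset.sum_le_sum fun l _ => (hm _).trans_eq ?_
  rw [dotProduct_comm]
  rfl

lemma finner_mul_comm {ι κ : Type*} [Fintype ι] [Fintype κ] {H : Matrix ι ι ℝ}
    (hH : Hᵀ = H) (X Y : Matrix ι κ ℝ) : finner (H * X) Y = finner (H * Y) X := by
  rw [finner_eq_trace, finner_eq_trace, ← Matrix.trace_transpose, Matrix.transpose_mul,
    Matrix.transpose_transpose, Matrix.transpose_mul, hH, Matrix.mul_assoc, ← Matrix.mul_assoc,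
    Matrix.trace_mul_comm, ← Matrix.mul_assoc]

lemma finner_mul_self_eq_trace {ι κ : Type*} [Fintype ι] [DecidableEq ι] [Fintype κ]
    {S : Matrix ι κ ℝ} (hS : S * Sᵀ = 1) (H : Matrix ι ι ℝ) : finner (H * S) S = H.trace := by
  rw [finner_eq_trace, Matrix.mul_assoc, hS, Matrix.mul_one]

lemma finner_sub_left {ι κ : Type*} [Fintype ι] [Fintype κ] (X Y Z : Matrix ι κ ℝ) :
    finner (X - Y) Z = finner X Z - finner Y Z := by
  simp only [finner, Matrix.sub_apply, sub_mul, Finset.sum_sub_distrib]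

lemma finner_comm {ι κ : Type*} [Fintype ι] [Fintype κ] (X Y : Matrix ι κ ℝ) :
    finner X Y = finner Y X := by
  simp only [finner, mul_comm]

/-- Stability of the polar decomposition. -/
lemma polar_stability {ι κ : Type*} [Fintype ι] [DecidableEq ι] [Fintype κ]
    {S Q : Matrix ι κ ℝ} (hS : S * Sᵀ = 1) (hQ : Q * Qᵀ = 1) {K H : Matrix ι ι ℝ}
    (hK : Kᵀ = K) (hH : Hᵀ = H) (hK0 : ∀ v, 0 ≤ v ⬝ᵥ K *ᵥ v) {m : ℝ} (hm0 : 0 ≤ m)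
    (hm : ∀ v, m * (v ⬝ᵥ v) ≤ v ⬝ᵥ H *ᵥ v) :
    m ^ 2 * finner (S - Q) (S - Q) ≤ 4 * finner (K * S - H * Q) (K * S - H * Q) := by
  have expand : ∀ M : Matrix ι ι ℝ, Mᵀ = M →
      finner (M * (S - Q)) (S - Q) = 2 * (M.trace - finner (M * S) Q) := fun M hM => by
    rw [Matrix.mul_sub, finner_sub_left, finner_comm, finner_sub_left, finner_comm (M * Q),
      finner_sub_left, finner_comm S, finner_comm Q, finner_mul_self_eq_trace hS,
      finner_comm S, finner_comm Q, finner_mul_self_eq_trace hQ, finner_mul_comm hM Q S]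
    ring
  have h1 : 0 ≤ finner (K * (S - Q)) (S - Q) := by
    have := finner_mul_self_ge (m := 0) (H := K) (by simpa using hK0) (S - Q)
    simpa using this
  have h2 := finner_mul_self_ge hm (S - Q)
  rw [expand K hK] at h1
  rw [expand H hH] at h2
  have h3 : finner (K * S - H * Q) (S - Q) =
      (K.trace - finner (K * S) Q) + (H.trace - finner (H * S) Q) := by
    rw [finner_comm, finner_sub_left, finner_comm S, finner_comm Q, finner_sub_left,
      finner_sub_left, finner_mul_self_eq_trace hS, finner_mul_self_eq_trace hQ,
      finner_mul_comm hH Q S]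
    ring
  have h4 := finner_le_frobNorm (K * S - H * Q) (S - Q)
  rw [← frobNorm_sq, ← frobNorm_sq, ← mul_pow]
  rw [← frobNorm_sq] at h2
  set e := frobNorm (S - Q)
  set f := frobNorm (K * S - H * Q)
  have he : 0 ≤ e := frobNorm_nonneg _
  have hf : 0 ≤ f := frobNorm_nonneg _
  have h5 : m * e ^ 2 ≤ 2 * f * e := by linarith
  have h6 : m * e ≤ 2 * f := by
    rcases he.eq_or_lt with h | h
    · rw [← h]; linarith
    · refine le_of_mul_le_mul_right ?_ h
      linarith
  calc (m * e) ^ 2 ≤ (2 * f) ^ 2 := pow_le_pow_left₀ (mul_nonneg hm0 he) h6 2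
    _ = 4 * f ^ 2 := by ring

end NoiseControl

section SmallBlocks

variable {n d p : ℕ}

lemma vnorm_noiseVec_le_frobNorm {G : Matrix (Fin n × Fin d) (Fin d) ℝ} (hG : StiefelBlocks G)
    (Δ : Matrix (Fin n × Fin d) (Fin n × Fin d) ℝ) (S : Matrix (Fin n × Fin d) (Fin p) ℝ)
    (i : Fin n) (a : Fin d → ℝ) :
    vnorm (noiseVec G Δ S i a) ≤ frobNorm (rowBlk (Δ * S) i) * vnorm a := by
  refine (vnorm_mulVec_le _ _).trans_eq ?_
  rw [frobNorm_transpose, hG.vnorm_rowBlk_mulVec]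

lemma sum_frobNorm_rowBlk_le (X : Matrix (Fin n × Fin d) (Fin p) ℝ) :
    (∑ i, frobNorm (rowBlk X i)) ^ 2 ≤ n * finner X X := by
  have := sq_sum_le_card_mul_sum_sq (s := Finset.univ) (f := fun i => frobNorm (rowBlk X i))
  rw [Finset.card_univ, Fintype.card_fin] at this
  simp only [frobNorm_sq] at this
  rwa [finner_eq_sum_rowBlk]

/-- A local maximizer is close to a rotation of the planted signal. -/
lemma isLocalMax.exists_close {G : Matrix (Fin n × Fin d) (Fin d) ℝ} (hG : StiefelBlocks G)
    {Δ : Matrix (Fin n × Fin d) (Fin n × Fin d) ℝ} (hΔ : Δ.IsSymm)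
    (hΔ0 : ∀ i, blk Δ i i = 0) (hn : 0 < n) {δ : ℝ} (hδ0 : 0 ≤ δ)
    (hδ : ∀ x y, x ⬝ᵥ Δ *ᵥ y ≤ δ * vnorm x * vnorm y) (hdp : 2 * d < p)
    (hδn : δ ≤ n / 20) (hδd : δ ^ 2 * d ≤ (n / 20) ^ 2)
    {S : Matrix (Fin n × Fin d) (Fin p) ℝ} (hS : isLocalMax (G * Gᵀ + Δ) S) :
    ∃ Q : Matrix (Fin d) (Fin p) ℝ, Q * Qᵀ = 1 ∧
      n * finner (S - G * Q) (S - G * Q) ≤ 256 * δ ^ 2 * d := by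
  have hA : (G * Gᵀ + Δ).IsSymm := isSymm_mul_transpose_add G hΔ
  have hn' : (0 : ℝ) < n := by exact_mod_cast hn
  set D : Fin n → Matrix (Fin d) (Fin p) ℝ := fun i => rowBlk (Δ * S) i with hD
  set Λ : Fin n → Matrix (Fin d) (Fin d) ℝ := fun i => multiplier (G * Gᵀ + Δ) S i with hΛ
  have htot : ∑ i, finner (D i) (D i) ≤ δ ^ 2 * (n * d) := by
    rw [← hS.1.finner_self, ← finner_eq_sum_rowBlk]
    exact finner_mul_self_le hδ0 hδ S
  obtain ⟨k, hk⟩ : ∃ k, finner (D k) (D k) ≤ δ ^ 2 * d := by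
    have hne : (Finset.univ : Finset (Fin n)).Nonempty := ⟨⟨0, hn⟩, Finset.mem_univ _⟩
    obtain ⟨k, -, hk⟩ := Finset.exists_le_of_sum_le (f := fun i => finner (D i) (D i))
      (g := fun _ => δ ^ 2 * (d : ℝ)) hne (htot.trans_eq (by
        rw [Finset.sum_const, Finset.card_univ, Fintype.card_fin, nsmul_eq_mul]; ring))
    exact ⟨k, hk⟩
  have hk' : frobNorm (D k) ≤ n / 20 := by
    refine le_of_abs_le (abs_le_of_sq_le_sq ?_ (by positivity))
    rw [frobNorm_sq]
    exact hk.trans hδd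
  have hsum' : ∑ i, frobNorm (D i) ≤ n * (n / 20) := by
    refine le_of_abs_le (abs_le_of_sq_le_sq ?_ (by positivity))
    refine (sum_frobNorm_rowBlk_le _).trans ?_
    rw [finner_eq_sum_rowBlk]
    calc n * ∑ i, finner (D i) (D i) ≤ n * (δ ^ 2 * (n * d)) :=
          mul_le_mul_of_nonneg_left htot hn'.le
      _ = n ^ 2 * (δ ^ 2 * d) := by ring
      _ ≤ n ^ 2 * (n / 20) ^ 2 := mul_le_mul_of_nonneg_left hδd (by positivity)
      _ = (n * (n / 20)) ^ 2 := by ring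
  have hΛk : ∀ v, (n / 4 : ℝ) * (v ⬝ᵥ v) ≤ v ⬝ᵥ Λ k *ᵥ v := fun v => by
    refine le_trans ?_ (hS.multiplier_ge hG hΔ hΔ0 hδ hdp k (η := n / 20) (fun a => ?_)
      (fun a => ?_) v)
    · exact mul_le_mul_of_nonneg_right (by linarith) (dotProduct_self_nonneg' v)
    · exact (vnorm_noiseVec_le_frobNorm hG Δ S k a).trans
        (mul_le_mul_of_nonneg_right hk' (vnorm_nonneg a))
    · refine (Finset.sum_le_sum fun j _ => vnorm_noiseVec_le_frobNorm hG Δ S j a).trans ?_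
      rw [← Finset.sum_mul]
      exact mul_le_mul_of_nonneg_right hsum' (vnorm_nonneg a)
  refine ⟨(rowBlk G k)ᵀ * rowBlk S k, ?_, ?_⟩
  · rw [Matrix.transpose_mul, Matrix.transpose_transpose, Matrix.mul_assoc,
      ← Matrix.mul_assoc (rowBlk S k), hS.1 k, Matrix.one_mul, hG.transpose_mul_self]
  have hi : ∀ i, (n : ℝ) ^ 2 * finner (rowBlk (S - G * ((rowBlk G k)ᵀ * rowBlk S k)) i)
      (rowBlk (S - G * ((rowBlk G k)ᵀ * rowBlk S k)) i) ≤
      128 * (finner (D i) (D i) + δ ^ 2 * d) := fun i => by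
    set R : Matrix (Fin d) (Fin d) ℝ := rowBlk G i * (rowBlk G k)ᵀ with hR
    have hRR : R * Rᵀ = 1 := by
      rw [hR, Matrix.transpose_mul, Matrix.transpose_transpose, Matrix.mul_assoc,
        ← Matrix.mul_assoc _ (rowBlk G k), hG.transpose_mul_self, Matrix.one_mul, hG i]
    have hRR' : Rᵀ * R = 1 := mul_eq_one_comm.1 hRR
    have e : rowBlk (S - G * ((rowBlk G k)ᵀ * rowBlk S k)) i = rowBlk S i - R * rowBlk S k := by
      rw [hR, Matrix.mul_assoc]
      rfl
    obtain ⟨hi1, hi2⟩ := hS.rowBlk_mul_eq hA i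
    obtain ⟨hk1, hk2⟩ := hS.rowBlk_mul_eq hA k
    have hpol := polar_stability (S := rowBlk S i) (Q := R * rowBlk S k) (K := Λ i)
      (H := R * Λ k * Rᵀ) (hS.1 i) (by
        rw [Matrix.transpose_mul, Matrix.mul_assoc, ← Matrix.mul_assoc (rowBlk S k), hS.1 k,
          Matrix.one_mul, hRR]) hi2 (by
        rw [Matrix.transpose_mul _ Rᵀ, Matrix.transpose_mul R, Matrix.transpose_transpose,
          Matrix.mul_assoc R]
        exact congrArg (fun M => R * (M * Rᵀ)) hk2)
      (hS.multiplier_nonneg hΔ hΔ0 (by omega) i) (m := n / 4) (by positivity) (fun v => by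
        have h := hΛk (Rᵀ *ᵥ v)
        rw [← vnorm_sq, _root_.vnorm_transpose_mulVec hRR, vnorm_sq] at h
        refine h.trans_eq ?_
        rw [← Matrix.mulVec_mulVec, ← Matrix.mulVec_mulVec]
        have := dotProduct_transpose_mulVec_eq Rᵀ v (Λ k *ᵥ Rᵀ *ᵥ v)
        rw [Matrix.transpose_transpose] at this
        exact this.symm)
    have ediff : Λ i * rowBlk S i - R * Λ k * Rᵀ * (R * rowBlk S k) = D i - R * D k := by
      have e1 : R * Λ k * Rᵀ * (R * rowBlk S k) = R * (Λ k * rowBlk S k) := by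
        rw [Matrix.mul_assoc (R * Λ k), ← Matrix.mul_assoc Rᵀ, hRR', Matrix.one_mul,
          Matrix.mul_assoc]
      rw [e1, hΛ]
      simp only
      rw [← hi1, ← hk1, rowBlk_mul_transpose_add_mul, rowBlk_mul_transpose_add_mul,
        Matrix.mul_add, ← Matrix.mul_assoc R, hR, Matrix.mul_assoc (rowBlk G i),
        hG.transpose_mul_self, Matrix.mul_one]
      abel
    rw [ediff] at hpol
    have h2 := finner_sub_self_le (D i) (R * D k)
    rw [finner_self_mul_left hRR'] at h2
    rw [e]
    nlinarith
  have hfin := Finset.sum_le_sum fun i (_ : i ∈ Finset.univ) => hi i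
  rw [← Finset.mul_sum, ← Finset.mul_sum, ← finner_eq_sum_rowBlk, Finset.sum_add_distrib,
    Finset.sum_const, Finset.card_univ, Fintype.card_fin, nsmul_eq_mul] at hfin
  refine le_of_mul_le_mul_left ?_ hn'
  nlinarith

/-- The assumptions on the noise under which the landscape is benign. -/
structure NoiseBound (G : Matrix (Fin n × Fin d) (Fin d) ℝ)
    (Δ : Matrix (Fin n × Fin d) (Fin n × Fin d) ℝ) (δ : ℝ) : Prop where
  isSymm : Δ.IsSymm
  blk_self : ∀ i, blk Δ i i = 0
  nonneg : 0 ≤ δ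
  form_le : ∀ x y, x ⬝ᵥ Δ *ᵥ y ≤ δ * vnorm x * vnorm y
  le_div : δ ≤ n / 20
  block_le : ∀ i v b, blockSingle i v ⬝ᵥ Δ *ᵥ (G *ᵥ b) ≤ n / 20 * vnorm v * vnorm b
  regime : δ ^ 2 * n ≤ (n / 20) ^ 2 ∨
    δ ^ 2 * d ≤ (n / 20) ^ 2 ∧ 256 * δ ^ 4 * d ≤ n * (n / 20) ^ 2

lemma isLocalMax.vnorm_noiseVec_le {G : Matrix (Fin n × Fin d) (Fin d) ℝ} (hG : StiefelBlocks G)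
    {Δ : Matrix (Fin n × Fin d) (Fin n × Fin d) ℝ} {δ : ℝ} (h : NoiseBound G Δ δ) (hn : 0 < n)
    (hdp : 2 * d < p) {S : Matrix (Fin n × Fin d) (Fin p) ℝ} (hS : isLocalMax (G * Gᵀ + Δ) S)
    (i : Fin n) (a : Fin d → ℝ) : vnorm (noiseVec G Δ S i a) ≤ n / 10 * vnorm a := by
  have hn' : (0 : ℝ) < n := by exact_mod_cast hn
  rcases h.regime with hr | ⟨hr1, hr2⟩
  · refine (vnorm_noiseVec_le_of_sqrt hG h.isSymm h.nonneg h.form_le hS.1 i a).trans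
      (mul_le_mul_of_nonneg_right ?_ (vnorm_nonneg a))
    refine le_trans (b := (n / 20 : ℝ))
      (le_of_abs_le (abs_le_of_sq_le_sq ?_ (by positivity))) (by linarith)
    rw [mul_pow, Real.sq_sqrt hn'.le]
    linarith
  · obtain ⟨Q, hQ, hE⟩ := hS.exists_close hG h.isSymm h.blk_self hn h.nonneg h.form_le hdp
      h.le_div hr1
    set E := S - G * Q with hEdef
    have hSE : S = E + G * Q := by rw [hEdef, sub_add_cancel]
    set u := Δ *ᵥ blockSingle i (rowBlk G i *ᵥ a) with hu
    have e : noiseVec G Δ S i a = Eᵀ *ᵥ u + Qᵀ *ᵥ (Gᵀ *ᵥ u) := by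
      rw [noiseVec_eq h.isSymm, ← hu]
      nth_rewrite 1 [hSE]
      rw [Matrix.transpose_add, Matrix.add_mulVec, Matrix.transpose_mul, Matrix.mulVec_mulVec u]
    have hu1 : vnorm u ≤ δ * vnorm a := by
      refine (vnorm_mulVec_le_of_form h.nonneg h.form_le _).trans_eq ?_
      rw [vnorm_blockSingle, hG.vnorm_rowBlk_mulVec]
    have h1 : vnorm (Eᵀ *ᵥ u) ≤ n / 20 * vnorm a := by
      refine (vnorm_mulVec_le _ _).trans ?_
      rw [frobNorm_transpose]
      refine (mul_le_mul_of_nonneg_left hu1 (frobNorm_nonneg _)).trans ?_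
      rw [← mul_assoc]
      refine mul_le_mul_of_nonneg_right ?_ (vnorm_nonneg a)
      refine le_of_abs_le (abs_le_of_sq_le_sq ?_ (by positivity))
      rw [mul_pow, frobNorm_sq]
      refine le_of_mul_le_mul_left ?_ hn'
      refine le_trans ?_ hr2
      have := mul_le_mul_of_nonneg_right hE (sq_nonneg δ)
      linarith
    have h2 : vnorm (Qᵀ *ᵥ (Gᵀ *ᵥ u)) ≤ n / 20 * vnorm a := by
      rw [vnorm_transpose_mulVec hQ]
      refine vnorm_le_of_dotProduct_le (mul_nonneg (by positivity) (vnorm_nonneg a)) ?_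
      rw [dotProduct_transpose_mulVec_eq, hu]
      have e2 : (G *ᵥ (Gᵀ *ᵥ Δ *ᵥ blockSingle i (rowBlk G i *ᵥ a))) ⬝ᵥ
          Δ *ᵥ blockSingle i (rowBlk G i *ᵥ a) =
          blockSingle i (rowBlk G i *ᵥ a) ⬝ᵥ
            Δ *ᵥ (G *ᵥ (Gᵀ *ᵥ Δ *ᵥ blockSingle i (rowBlk G i *ᵥ a))) := by
        rw [dotProduct_comm (blockSingle i _), ← dotProduct_transpose_mulVec_eq Δ, h.isSymm]
      rw [e2]
      refine (h.block_le _ _ _).trans_eq ?_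
      rw [hG.vnorm_rowBlk_mulVec]
    rw [e]
    refine (vnorm_add_le _ _).trans ?_
    linarith

lemma isLocalMax.multiplier_ge_quarter {G : Matrix (Fin n × Fin d) (Fin d) ℝ}
    (hG : StiefelBlocks G) {Δ : Matrix (Fin n × Fin d) (Fin n × Fin d) ℝ} {δ : ℝ}
    (h : NoiseBound G Δ δ) (hn : 0 < n) (hdp : 2 * d < p)
    {S : Matrix (Fin n × Fin d) (Fin p) ℝ} (hS : isLocalMax (G * Gᵀ + Δ) S) (i : Fin n)
    (v : Fin d → ℝ) :
    (n / 4 : ℝ) * (v ⬝ᵥ v) ≤ v ⬝ᵥ multiplier (G * Gᵀ + Δ) S i *ᵥ v := by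
  refine le_trans ?_ (hS.multiplier_ge hG h.isSymm h.blk_self h.form_le hdp i (η := n / 10)
    (hS.vnorm_noiseVec_le hG h hn hdp i) (fun a => ?_) v)
  · exact mul_le_mul_of_nonneg_right (by linarith [h.le_div]) (dotProduct_self_nonneg' v)
  · refine (Finset.sum_le_sum fun j _ => hS.vnorm_noiseVec_le hG h hn hdp j a).trans_eq ?_
    rw [Finset.sum_const, Finset.card_univ, Fintype.card_fin, nsmul_eq_mul]
    ring

end SmallBlocks

section Certificate

variable {n d p : ℕ}

lemma StiefelBlocks.sdpFeasible_mul_transpose {S : Matrix (Fin n × Fin d) (Fin p) ℝ}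
    (hS : StiefelBlocks S) : sdpFeasible (S * Sᵀ) := by
  refine ⟨?_, ?_, hS⟩
  · rw [Matrix.IsSymm, Matrix.transpose_mul, Matrix.transpose_transpose]
  · have := Matrix.posSemidef_self_mul_conjTranspose S
    rwa [Matrix.conjTranspose_eq_transpose_of_trivial] at this

lemma finner_blkDiag (D : Fin n → Matrix (Fin d) (Fin d) ℝ)
    (Y : Matrix (Fin n × Fin d) (Fin n × Fin d) ℝ) :
    finner (blkDiag D) Y = ∑ i, finner (D i) (blk Y i i) := by
  simp only [finner, blkDiag, blk, Fintype.sum_prod_type, ite_mul, zero_mul]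
  refine Finset.sum_congr rfl fun i _ => Finset.sum_congr rfl fun k _ => ?_
  rw [Finset.sum_eq_single i]
  · simp
  · intro j _ hj
    simp [hj.symm]
  · simp

lemma vblk_blkDiag_mulVec (D : Fin n → Matrix (Fin d) (Fin d) ℝ) (u : Fin n × Fin d → ℝ)
    (i : Fin n) : vblk (blkDiag D *ᵥ u) i = D i *ᵥ vblk u i := by
  ext k
  simp only [vblk, Matrix.mulVec, dotProduct, blkDiag, Fintype.sum_prod_type, ite_mul, zero_mul]
  rw [Finset.sum_eq_single i]
  · simp
  · intro j _ hj
    simp [hj.symm]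
  · simp

lemma dotProduct_blkDiag_mulVec (D : Fin n → Matrix (Fin d) (Fin d) ℝ) (u : Fin n × Fin d → ℝ) :
    u ⬝ᵥ blkDiag D *ᵥ u = ∑ i, vblk u i ⬝ᵥ D i *ᵥ vblk u i := by
  rw [dotProduct_eq_sum_vblk]
  simp only [vblk_blkDiag_mulVec]

lemma rowBlk_blkDiag_mul (D : Fin n → Matrix (Fin d) (Fin d) ℝ)
    (S : Matrix (Fin n × Fin d) (Fin p) ℝ) (i : Fin n) :
    rowBlk (blkDiag D * S) i = D i * rowBlk S i := by
  ext k l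
  exact congrFun (vblk_blkDiag_mulVec D (S.col l) i) k

lemma blkDiag_isSymm {D : Fin n → Matrix (Fin d) (Fin d) ℝ} (hD : ∀ i, (D i)ᵀ = D i) :
    (blkDiag D).IsSymm := by
  ext q r
  simp only [Matrix.transpose_apply, blkDiag]
  by_cases h : q.1 = r.1
  · rw [if_pos h, if_pos h.symm, h]
    exact congrFun (congrFun (hD r.1) q.2) r.2
  · rw [if_neg h, if_neg (Ne.symm h)]

open scoped MatrixOrder Matrix.Norms.L2Operator in
lemma exists_eq_transpose_mul_self {ι : Type*} [Fintype ι] {Y : Matrix ι ι ℝ}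
    (hY : Y.PosSemidef) : ∃ B : Matrix ι ι ℝ, Y = Bᵀ * B := by
  classical
  obtain ⟨B, hB⟩ := CStarAlgebra.nonneg_iff_eq_star_mul_self.mp hY.nonneg
  exact ⟨B, by rw [hB, Matrix.star_eq_conjTranspose,
    Matrix.conjTranspose_eq_transpose_of_trivial]⟩

/-- A dual certificate that is coercive on the orthogonal complement of the columns of `G` and
annihilates a matrix with an identity block pins down the feasible points it annihilates. -/
lemma eq_mul_transpose_of_certificate {L : Matrix (Fin n × Fin d) (Fin n × Fin d) ℝ}
    (hL : L.IsSymm) {G R : Matrix (Fin n × Fin d) (Fin d) ℝ} (hLR : L * R = 0) {i₀ : Fin n}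
    (hR : rowBlk R i₀ = 1) {c : ℝ} (hc : 0 < c)
    (hcoer : ∀ u, Gᵀ *ᵥ u = 0 → c * (u ⬝ᵥ u) ≤ u ⬝ᵥ L *ᵥ u)
    {Y : Matrix (Fin n × Fin d) (Fin n × Fin d) ℝ} (hY : Y.PosSemidef) (hY0 : blk Y i₀ i₀ = 1) :
    0 ≤ finner L Y ∧ (finner L Y = 0 → Y = R * Rᵀ) := by
  have hLRv : ∀ a, L *ᵥ (R *ᵥ a) = 0 := fun a => by
    rw [Matrix.mulVec_mulVec, hLR, Matrix.zero_mulVec]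
  have hRv : ∀ a, vblk (R *ᵥ a) i₀ = a := fun a => by
    rw [vblk_mulVec, hR, Matrix.one_mulVec]
  have hzero : ∀ u, Gᵀ *ᵥ u = 0 → u ⬝ᵥ L *ᵥ u ≤ 0 → u = 0 := fun u hu h => by
    have h1 := (hcoer u hu).trans h
    have h2 := dotProduct_self_nonneg' u
    exact dotProduct_self_eq_zero.1 (by nlinarith)
  have hinj : Function.Injective (Gᵀ * R).mulVec := by
    rw [← Matrix.coe_mulVecLin, ← LinearMap.ker_eq_bot, LinearMap.ker_eq_bot']
    intro a ha
    rw [Matrix.mulVecLin_apply, ← Matrix.mulVec_mulVec] at ha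
    have := hzero _ ha (by rw [hLRv, dotProduct_zero])
    rw [← hRv a, this]
    rfl
  have hsurj : Function.Surjective (Gᵀ * R).mulVec :=
    Matrix.mulVec_surjective_iff_isUnit.2 (Matrix.mulVec_injective_iff_isUnit.1 hinj)
  have hdecomp : ∀ u, ∃ a, Gᵀ *ᵥ (u - R *ᵥ a) = 0 ∧
      u ⬝ᵥ L *ᵥ u = (u - R *ᵥ a) ⬝ᵥ L *ᵥ (u - R *ᵥ a) := fun u => by
    obtain ⟨a, ha⟩ := hsurj (Gᵀ *ᵥ u)
    refine ⟨a, ?_, ?_⟩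
    · rw [Matrix.mulVec_sub, Matrix.mulVec_mulVec, ha, sub_self]
    · rw [Matrix.mulVec_sub, hLRv, sub_zero, sub_dotProduct]
      have : (R *ᵥ a) ⬝ᵥ L *ᵥ u = 0 := by
        rw [← hL, dotProduct_transpose_mulVec_eq, hLRv, zero_dotProduct]
      rw [this, sub_zero]
  have hpos : ∀ u, 0 ≤ u ⬝ᵥ L *ᵥ u := fun u => by
    obtain ⟨a, ha, h⟩ := hdecomp u
    rw [h]
    exact (mul_nonneg hc.le (dotProduct_self_nonneg' _)).trans (hcoer _ ha)
  have hker : ∀ u, u ⬝ᵥ L *ᵥ u = 0 → u = R *ᵥ vblk u i₀ := fun u hu => by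
    obtain ⟨a, ha, h⟩ := hdecomp u
    have h1 : u = R *ᵥ a := sub_eq_zero.1 (hzero _ ha (by rw [← h, hu]))
    have h2 : vblk u i₀ = a := by rw [h1, hRv]
    rw [h2, ← h1]
  obtain ⟨B, hB⟩ := exists_eq_transpose_mul_self hY
  have hBt : Y = Bᵀ * Bᵀᵀ := by rw [Matrix.transpose_transpose, hB]
  have hsum : finner L Y = ∑ l, Bᵀ.col l ⬝ᵥ L *ᵥ Bᵀ.col l := by
    rw [← finner_mul_transpose_self_eq_sum, ← hBt]
  refine ⟨hsum ▸ Finset.sum_nonneg fun l _ => hpos _, fun h0 => ?_⟩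
  rw [hsum, Finset.sum_eq_zero_iff_of_nonneg fun l _ => hpos _] at h0
  let B₀ : Matrix (Fin d) (Fin n × Fin d) ℝ := fun k l => B l (i₀, k)
  have hBR : Bᵀ = R * B₀ := by
    ext q l
    exact congrFun (hker _ (h0 l (Finset.mem_univ l))) q
  have hB₀ : B₀ * B₀ᵀ = 1 := by
    rw [← hY0, hBt]
    rfl
  rw [hBt, hBR, Matrix.transpose_mul, Matrix.mul_assoc, ← Matrix.mul_assoc B₀, hB₀, Matrix.one_mul]

lemma rank_mul_transpose_of_rowBlk_eq_one {R : Matrix (Fin n × Fin d) (Fin d) ℝ} {i₀ : Fin n}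
    (hR : rowBlk R i₀ = 1) : (R * Rᵀ).rank = d := by
  rw [Matrix.rank_self_mul_transpose]
  have hinj : Function.Injective R.mulVecLin := fun a b hab => by
    have h : ∀ a, vblk (R *ᵥ a) i₀ = a := fun a => by
      rw [vblk_mulVec, hR, Matrix.one_mulVec]
    rw [← h a, ← h b]
    exact congrArg (fun x => vblk x i₀) hab
  rw [Matrix.rank, LinearMap.finrank_range_of_inj hinj]
  simp

lemma isLocalMax.sdp_unique {G : Matrix (Fin n × Fin d) (Fin d) ℝ}
    (hG : StiefelBlocks G) {Δ : Matrix (Fin n × Fin d) (Fin n × Fin d) ℝ} {δ : ℝ}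
    (h : NoiseBound G Δ δ) (hn : 0 < n) (hdp : 2 * d < p)
    {S : Matrix (Fin n × Fin d) (Fin p) ℝ} (hS : isLocalMax (G * Gᵀ + Δ) S) :
    sdpMaximizer (G * Gᵀ + Δ) (S * Sᵀ) ∧
      (∀ Y, sdpMaximizer (G * Gᵀ + Δ) Y → Y = S * Sᵀ) ∧ (S * Sᵀ).rank = d ∧
      ∃ R : Matrix (Fin n × Fin d) (Fin d) ℝ,
        progPMaximizer (G * Gᵀ + Δ) R ∧ S * Sᵀ = R * Rᵀ := by
  have hn' : (0 : ℝ) < n := by exact_mod_cast hn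
  set A := G * Gᵀ + Δ with hAdef
  have hA : A.IsSymm := isSymm_mul_transpose_add G h.isSymm
  set Λ : Fin n → Matrix (Fin d) (Fin d) ℝ := multiplier A S with hΛ
  set L := blkDiag Λ - A with hLdef
  have hL : L.IsSymm := (blkDiag_isSymm fun i => (hS.rowBlk_mul_eq hA i).2).sub hA
  have hLS : L * S = 0 := by
    rw [hLdef, Matrix.sub_mul, sub_eq_zero]
    ext ⟨i, k⟩ l
    have := (rowBlk_blkDiag_mul Λ S i).trans (hS.rowBlk_mul_eq hA i).1.symm
    exact congrFun (congrFun this k) l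
  let i₀ : Fin n := ⟨0, hn⟩
  set R := S * (rowBlk S i₀)ᵀ with hRdef
  have hLR : L * R = 0 := by rw [hRdef, ← Matrix.mul_assoc, hLS, Matrix.zero_mul]
  have hR0 : rowBlk R i₀ = 1 := hS.1 i₀
  have hcoer : ∀ u, Gᵀ *ᵥ u = 0 → (n / 5 : ℝ) * (u ⬝ᵥ u) ≤ u ⬝ᵥ L *ᵥ u := fun u hu => by
    have h1 : (n / 4 : ℝ) * (u ⬝ᵥ u) ≤ u ⬝ᵥ blkDiag Λ *ᵥ u := by
      rw [dotProduct_blkDiag_mulVec, dotProduct_eq_sum_vblk, Finset.mul_sum]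
      exact Finset.sum_le_sum fun i _ => hS.multiplier_ge_quarter hG h hn hdp i _
    have h2 := h.form_le u u
    rw [mul_assoc, ← sq, vnorm_sq] at h2
    have h3 := mul_le_mul_of_nonneg_right h.le_div (dotProduct_self_nonneg' u)
    rw [hLdef, hAdef, Matrix.sub_mulVec, Matrix.add_mulVec, dotProduct_sub, dotProduct_add,
      dotProduct_mul_transpose_mulVec, hu, dotProduct_zero]
    linarith
  have key : ∀ {Y}, sdpFeasible Y → 0 ≤ finner L Y ∧ (finner L Y = 0 → Y = R * Rᵀ) :=
    fun hY => eq_mul_transpose_of_certificate hL hLR hR0 (by positivity) hcoer hY.2.1 (hY.2.2 i₀)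
  have hval : ∀ {Y}, sdpFeasible Y →
      finner A Y = (∑ i, finner (Λ i) (1 : Matrix (Fin d) (Fin d) ℝ)) - finner L Y := fun hY => by
    rw [hLdef, finner_sub_left, finner_blkDiag]
    simp only [hY.2.2]
    ring
  have hX : sdpFeasible (S * Sᵀ) := hS.1.sdpFeasible_mul_transpose
  have hLX : finner L (S * Sᵀ) = 0 := by
    rw [finner_mul_transpose, hLS]
    simp [finner]
  have hXR : S * Sᵀ = R * Rᵀ := (key hX).2 hLX
  have hmax : ∀ Y, sdpFeasible Y → finner A Y ≤ finner A (S * Sᵀ) := fun Y hY => by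
    rw [hval hY, hval hX, hLX]
    linarith [(key hY).1]
  refine ⟨⟨hX, hmax⟩, fun Y hY => ?_, ?_, R, ⟨fun i => ?_, fun R' hR' => ?_⟩, hXR⟩
  · rw [hXR]
    refine (key hY.1).2 (le_antisymm ?_ (key hY.1).1)
    have := hY.2 _ hX
    rw [hval hX, hval hY.1, hLX] at this
    linarith
  · rw [hXR]
    exact rank_mul_transpose_of_rowBlk_eq_one hR0
  · have := hX.2.2 i
    rw [hXR] at this
    exact this
  · rw [← hXR]
    exact hmax _ hR'.sdpFeasible_mul_transpose

lemma isCompact_setOf_stiefelBlocks :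
    IsCompact {S : Matrix (Fin n × Fin d) (Fin p) ℝ | StiefelBlocks S} := by
  have hK : IsCompact (Set.pi Set.univ fun _ : Fin n × Fin d =>
      Set.pi Set.univ fun _ : Fin p => Set.Icc (-1 : ℝ) 1) :=
    isCompact_univ_pi fun _ => isCompact_univ_pi fun _ => isCompact_Icc
  refine IsCompact.of_isClosed_subset hK ?_ fun S hS => ?_
  · have : {S : Matrix (Fin n × Fin d) (Fin p) ℝ | StiefelBlocks S} =
        ⋂ i, {S | rowBlk S i * (rowBlk S i)ᵀ = 1} := by
      ext S
      simp [StiefelBlocks]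
    rw [this]
    refine isClosed_iInter fun i => isClosed_eq ?_ continuous_const
    have hc : Continuous fun S : Matrix (Fin n × Fin d) (Fin p) ℝ => rowBlk S i :=
      continuous_matrix fun k l => continuous_id.matrix_elem (i, k) l
    exact hc.matrix_mul hc.matrix_transpose
  · change StiefelBlocks S at hS
    rintro ⟨i, k⟩ - l -
    have h : ∑ l, S (i, k) l * S (i, k) l = 1 := by
      simpa [Matrix.mul_apply, rowBlk] using congrFun (congrFun (hS i) k) k
    have h1 := Finset.single_le_sum (f := fun l => S (i, k) l * S (i, k) l)
      (fun l _ => mul_self_nonneg _) (Finset.mem_univ l)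
    rw [h] at h1
    exact ⟨by nlinarith, by nlinarith⟩

lemma exists_isLocalMax (hdp : d ≤ p) (A : Matrix (Fin n × Fin d) (Fin n × Fin d) ℝ) :
    ∃ S : Matrix (Fin n × Fin d) (Fin p) ℝ, isLocalMax A S := by
  have hne : {S : Matrix (Fin n × Fin d) (Fin p) ℝ | StiefelBlocks S}.Nonempty := by
    refine ⟨fun q l => if Fin.castLE hdp q.2 = l then 1 else 0, fun i => ?_⟩
    ext k k'
    simp only [Matrix.mul_apply, Matrix.transpose_apply, rowBlk, Matrix.one_apply]
    simp [eq_comm]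
  have hc : Continuous fun S : Matrix (Fin n × Fin d) (Fin p) ℝ => finner A (S * Sᵀ) := by
    have h1 : Continuous fun S : Matrix (Fin n × Fin d) (Fin p) ℝ => S * Sᵀ :=
      continuous_id.matrix_mul continuous_id.matrix_transpose
    unfold finner
    exact continuous_finsetSum _ fun q _ => continuous_finsetSum _ fun r _ =>
      continuous_const.mul (h1.matrix_elem q r)
  obtain ⟨S, hS, hmax⟩ := isCompact_setOf_stiefelBlocks.exists_isMaxOn hne hc.continuousOn
  exact ⟨S, hS, 1, one_pos, fun S' hS' _ => hmax hS'⟩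

theorem NoiseBound.landscape {G : Matrix (Fin n × Fin d) (Fin d) ℝ}
    (hG : StiefelBlocks G) {Δ : Matrix (Fin n × Fin d) (Fin n × Fin d) ℝ} {δ : ℝ}
    (h : NoiseBound G Δ δ) (hn : 0 < n) (hdp : 2 * d < p) :
    ∃ X : Matrix (Fin n × Fin d) (Fin n × Fin d) ℝ,
      sdpMaximizer (G * Gᵀ + Δ) X ∧ (∀ Y, sdpMaximizer (G * Gᵀ + Δ) Y → Y = X) ∧ X.rank = d ∧
      (∃ R : Matrix (Fin n × Fin d) (Fin d) ℝ, progPMaximizer (G * Gᵀ + Δ) R ∧ X = R * Rᵀ) ∧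
      ∀ S : Matrix (Fin n × Fin d) (Fin p) ℝ, isLocalMax (G * Gᵀ + Δ) S → S * Sᵀ = X := by
  obtain ⟨S, hS⟩ := exists_isLocalMax (n := n) (p := p) (by omega : d ≤ p) (G * Gᵀ + Δ)
  obtain ⟨h1, h2, h3, h4⟩ := hS.sdp_unique hG h hn hdp
  exact ⟨S * Sᵀ, h1, h2, h3, h4, fun S' hS' => h2 _ (hS'.sdp_unique hG h hn hdp).1⟩

end Certificate

section GaussianSum

lemma hasSubgaussianMGF_gaussianReal : HasSubgaussianMGF (fun x : ℝ => x) 1 (gaussianReal 0 1) where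
  integrable_exp_mul := integrable_exp_mul_gaussianReal
  mgf_le t := by rw [mgf_fun_id_gaussianReal]; simp

lemma measure_pi_gaussianReal_sum_ge_le {ι : Type*} [Fintype ι] (c : ι → ℝ) {V t : ℝ}
    (hV : 0 < V) (hc : ∑ z, c z ^ 2 ≤ V) (ht : 0 ≤ t) :
    (Measure.pi fun _ : ι => gaussianReal 0 1).real {ω | t ≤ ∑ z, c z * ω z} ≤
      Real.exp (-t ^ 2 / (2 * V)) := by
  have hind : iIndepFun (fun (z : ι) (ω : ι → ℝ) => c z * ω z)
      (Measure.pi fun _ : ι => gaussianReal 0 1) :=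
    iIndepFun_pi (X := fun z (x : ℝ) => c z * x) fun z => (measurable_const_mul (c z)).aemeasurable
  have hsub : ∀ z ∈ (Finset.univ : Finset ι),
      HasSubgaussianMGF (fun ω : ι → ℝ => c z * ω z) (c z ^ 2).toNNReal
        (Measure.pi fun _ : ι => gaussianReal 0 1) := fun z _ => by
    have h : HasSubgaussianMGF (fun ω : ι → ℝ => ω z) 1
        (Measure.pi fun _ : ι => gaussianReal 0 1) := by
      refine HasSubgaussianMGF.of_map (Y := fun ω : ι → ℝ => ω z) (X := fun x : ℝ => x)
        (measurable_pi_apply z).aemeasurable ?_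
      have := (measurePreserving_eval (fun _ : ι => gaussianReal 0 1) z).map_eq
      rw [show (fun ω : ι → ℝ => ω z) = Function.eval z from rfl, this]
      exact hasSubgaussianMGF_gaussianReal
    rw [Real.toNNReal_of_nonneg (sq_nonneg (c z))]
    convert h.const_mul (c z) using 1
    exact (mul_one (M := NNReal) _).symm
  have hsum := HasSubgaussianMGF.sum_of_iIndepFun hind hsub
  have hV' : HasSubgaussianMGF (fun ω : ι → ℝ => ∑ z, c z * ω z) V.toNNReal
      (Measure.pi fun _ : ι => gaussianReal 0 1) :=
    { integrable_exp_mul := hsum.integrable_exp_mul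
      mgf_le := fun s => (hsum.mgf_le s).trans <| Real.exp_le_exp.mpr <| by
        rw [NNReal.coe_sum, Real.coe_toNNReal _ hV.le]
        simp only [Real.coe_toNNReal _ (sq_nonneg _)]
        have := mul_le_mul_of_nonneg_right hc (sq_nonneg s)
        linarith }
  simpa only [Real.coe_toNNReal _ hV.le] using hV'.measure_ge_le ht

end GaussianSum

section Net

/-- A real number from a sign and an absolute value. -/
def signed (e : Bool × ℕ) : ℝ := if e.1 then e.2 else -e.2

lemma signed_sq (e : Bool × ℕ) : signed e ^ 2 = (e.2 : ℝ) ^ 2 := by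
  unfold signed
  split_ifs <;> ring

lemma exists_signed_eq_intCast (k : ℤ) : ∃ e : Bool × ℕ, signed e = k ∧ (e.2 : ℝ) = |(k : ℝ)| := by
  refine ⟨(decide (0 ≤ k), k.natAbs), ?_, by simp [Nat.cast_natAbs]⟩
  rcases le_or_gt 0 k with hk | hk
  · simp [signed, hk, Nat.cast_natAbs, abs_of_nonneg]
  · simp [signed, hk.not_ge, Nat.cast_natAbs, abs_of_neg hk]

lemma exists_signed_round (y a : ℝ) :
    ∃ e : Bool × ℕ, (e.2 : ℝ) ≤ |y| + 1 ∧ a * y ≤ a * signed e := by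
  have key : ∃ k : ℤ, |(k : ℝ) - y| ≤ 1 ∧ a * y ≤ a * k := by
    rcases le_total 0 a with ha | ha
    · exact ⟨⌈y⌉, abs_le.mpr ⟨by linarith [Int.le_ceil y], by linarith [Int.ceil_lt_add_one y]⟩,
        mul_le_mul_of_nonneg_left (Int.le_ceil y) ha⟩
    · exact ⟨⌊y⌋, abs_le.mpr ⟨by linarith [Int.lt_floor_add_one y], by linarith [Int.floor_le y]⟩,
        mul_le_mul_of_nonpos_left (Int.floor_le y) ha⟩
  obtain ⟨k, hk, hka⟩ := key
  obtain ⟨e, he, he'⟩ := exists_signed_eq_intCast k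
  refine ⟨e, ?_, by rwa [he]⟩
  have := abs_sub_abs_le_abs_sub (k : ℝ) y
  linarith

variable (ι : Type*) [Fintype ι]

open Classical in
/-- Integer points, in sign and absolute value form, of bounded `ℓ¹` and `ℓ²` norm. -/
def latticeNet : Finset (ι → Bool × ℕ) :=
  {k ∈ Fintype.piFinset fun _ => Finset.univ ×ˢ Finset.range (2 * Fintype.card ι + 1) |
    ∑ i, (k i).2 ≤ 2 * Fintype.card ι ∧ ∑ i, (k i).2 ^ 2 ≤ 4 * Fintype.card ι}

lemma card_latticeNet_le : ((latticeNet ι).card : ℝ) ≤ 16 ^ Fintype.card ι := by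
  classical
  have h1 : ∀ k ∈ latticeNet ι,
      (1 : ℝ) ≤ 4 ^ Fintype.card ι * ∏ i, (1 / (2 : ℝ)) ^ (k i).2 := fun k hk => by
    rw [latticeNet, Finset.mem_filter] at hk
    rw [Finset.prod_pow_eq_pow_sum, one_div, inv_pow, ← div_eq_mul_inv, le_div_iff₀ (by positivity),
      one_mul, show (4 : ℝ) = 2 ^ 2 by norm_num, ← pow_mul]
    exact pow_le_pow_right₀ (by norm_num) hk.2.1
  calc ((latticeNet ι).card : ℝ) = ∑ k ∈ latticeNet ι, (1 : ℝ) := by simp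
    _ ≤ ∑ k ∈ latticeNet ι, 4 ^ Fintype.card ι * ∏ i, (1 / (2 : ℝ)) ^ (k i).2 :=
        Finset.sum_le_sum h1
    _ ≤ ∑ k ∈ Fintype.piFinset fun _ : ι =>
          (Finset.univ : Finset Bool) ×ˢ Finset.range (2 * Fintype.card ι + 1),
          4 ^ Fintype.card ι * ∏ i, (1 / (2 : ℝ)) ^ (k i).2 :=
        Finset.sum_le_sum_of_subset_of_nonneg (Finset.filter_subset _ _)
          fun _ _ _ => by positivity
    _ = 4 ^ Fintype.card ι * ∏ _i : ι, ∑ e ∈ (Finset.univ : Finset Bool) ×ˢ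
          Finset.range (2 * Fintype.card ι + 1), (1 / (2 : ℝ)) ^ e.2 := by
        rw [← Finset.mul_sum, Finset.prod_univ_sum]
    _ ≤ 4 ^ Fintype.card ι * ∏ _i : ι, 4 := by
        gcongr with i
        rw [Finset.sum_product]
        have := sum_geometric_two_le (2 * Fintype.card ι + 1)
        simp only [Finset.sum_const, Finset.card_univ, Fintype.card_bool, nsmul_eq_mul]
        push_cast
        linarith
    _ = 16 ^ Fintype.card ι := by
        rw [Finset.prod_const, Finset.card_univ, ← mul_pow]
        norm_num

/-- The real vector of a point of `latticeNet`. -/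
def netPoint (k : ι → Bool × ℕ) : ι → ℝ := fun i => signed (k i) / Real.sqrt (Fintype.card ι)

variable {ι}

lemma netPoint_dotProduct_self_le {k : ι → Bool × ℕ} (hk : k ∈ latticeNet ι) :
    netPoint ι k ⬝ᵥ netPoint ι k ≤ 4 := by
  rw [latticeNet, Finset.mem_filter] at hk
  have h : ((∑ i, (k i).2 ^ 2 : ℕ) : ℝ) ≤ (4 * Fintype.card ι : ℕ) := by exact_mod_cast hk.2.2
  push_cast at h
  calc netPoint ι k ⬝ᵥ netPoint ι k = (∑ i, ((k i).2 : ℝ) ^ 2) / Fintype.card ι := by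
        rw [dotProduct, Finset.sum_div]
        refine Finset.sum_congr rfl fun i _ => ?_
        rw [← sq, netPoint, div_pow, signed_sq, Real.sq_sqrt (Nat.cast_nonneg _)]
    _ ≤ 4 := div_le_of_le_mul₀ (Nat.cast_nonneg _) (by norm_num) h

lemma exists_dotProduct_le_netPoint {u : ι → ℝ} (hu : u ⬝ᵥ u ≤ 1) (a : ι → ℝ) :
    ∃ k ∈ latticeNet ι, a ⬝ᵥ u ≤ a ⬝ᵥ netPoint ι k := by
  classical
  set N := Fintype.card ι with hN
  set s := Real.sqrt N with hs
  have hss : s ^ 2 = N := Real.sq_sqrt (Nat.cast_nonneg _)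
  have hs0 : 0 ≤ s := Real.sqrt_nonneg _
  choose k hk hka using fun i => exists_signed_round (s * u i) (a i)
  have hu2 : ∑ i, |u i| ^ 2 ≤ 1 := by simpa [dotProduct, sq] using hu
  have hu1 : ∑ i, |u i| ≤ s := by
    have := sq_sum_le_card_mul_sum_sq (s := Finset.univ) (f := fun i => |u i|)
    rw [Finset.card_univ, ← hN] at this
    refine abs_le_of_sq_le_sq' (?_ : _ ≤ s ^ 2) hs0 |>.2
    rw [hss]
    nlinarith [Nat.cast_nonneg (α := ℝ) N]
  have h1 : ∑ i, (k i).2 ≤ 2 * N := by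
    have : (∑ i, ((k i).2 : ℝ)) ≤ ∑ i, (s * |u i| + 1) :=
      Finset.sum_le_sum fun i _ => by simpa [abs_mul, abs_of_nonneg hs0] using hk i
    rw [Finset.sum_add_distrib, ← Finset.mul_sum, Finset.sum_const, Finset.card_univ, ← hN,
      nsmul_eq_mul, mul_one] at this
    have h2 : (∑ i, ((k i).2 : ℝ)) ≤ 2 * N := by nlinarith
    exact_mod_cast h2
  have h2 : ∑ i, (k i).2 ^ 2 ≤ 4 * N := by
    have : (∑ i, ((k i).2 : ℝ) ^ 2) ≤ ∑ i, (2 * (s ^ 2 * |u i| ^ 2) + 2) :=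
      Finset.sum_le_sum fun i _ => by
        have h3 := hk i
        rw [abs_mul, abs_of_nonneg hs0] at h3
        nlinarith [Nat.cast_nonneg (α := ℝ) (k i).2, sq_nonneg (s * |u i| - 1),
          mul_nonneg hs0 (abs_nonneg (u i))]
    rw [Finset.sum_add_distrib, ← Finset.mul_sum, ← Finset.mul_sum, Finset.sum_const,
      Finset.card_univ, ← hN, nsmul_eq_mul, hss] at this
    have h3 : (∑ i, ((k i).2 : ℝ) ^ 2) ≤ 4 * N := by nlinarith [Nat.cast_nonneg (α := ℝ) N]
    exact_mod_cast h3
  refine ⟨k, ?_, ?_⟩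
  · rw [latticeNet, Finset.mem_filter, Fintype.mem_piFinset]
    refine ⟨fun i => ?_, h1, h2⟩
    have := Finset.single_le_sum (f := fun i => (k i).2) (fun _ _ => Nat.zero_le _)
      (Finset.mem_univ i)
    simp only [Finset.mem_product, Finset.mem_univ, Finset.mem_range, true_and]
    omega
  · refine Finset.sum_le_sum fun i _ => ?_
    have hpos : 0 < s := Real.sqrt_pos.mpr (by exact_mod_cast Fintype.card_pos_iff.mpr ⟨i⟩)
    rw [netPoint, ← hN, ← hs, ← mul_div_assoc, le_div_iff₀ hpos]
    linarith [hka i]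

end Net

section GaussianForm

variable {n d : ℕ}

lemma dotProduct_wof_mulVec (x y : Fin n × Fin d → ℝ)
    (ω : (Fin n × Fin d) × (Fin n × Fin d) → ℝ) :
    x ⬝ᵥ Wof ω *ᵥ y =
      ∑ z : (Fin n × Fin d) × (Fin n × Fin d),
        (if z.1.1 < z.2.1 then x z.1 * y z.2 + x z.2 * y z.1 else 0) * ω z := by
  have h : ∀ q r, x q * (Wof ω q r * y r) =
      (if q.1 < r.1 then x q * y r * ω (q, r) else 0) +
        if r.1 < q.1 then x q * y r * ω (r, q) else 0 := fun q r => by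
    unfold Wof
    rcases lt_trichotomy q.1 r.1 with h | h | h
    · simp only [h, h.asymm, if_true, if_false]; ring
    · simp [h]
    · simp only [h, h.asymm, if_true, if_false]; ring
  simp only [dotProduct, mulVec, Finset.mul_sum, h, Finset.sum_add_distrib]
  rw [Finset.sum_comm (f := fun q r : Fin n × Fin d =>
    if r.1 < q.1 then x q * y r * ω (r, q) else 0)]
  rw [← Finset.sum_add_distrib]
  refine Eq.trans (Finset.sum_congr rfl fun q _ => ?_) (Fintype.sum_prod_type _).symm
  rw [← Finset.sum_add_distrib]
  refine Finset.sum_congr rfl fun r _ => ?_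
  split_ifs <;> ring

lemma sum_wof_coeff_sq_le (x y : Fin n × Fin d → ℝ) :
    ∑ z : (Fin n × Fin d) × (Fin n × Fin d),
      (if z.1.1 < z.2.1 then x z.1 * y z.2 + x z.2 * y z.1 else 0) ^ 2 ≤
      4 * (x ⬝ᵥ x) * (y ⬝ᵥ y) := by
  calc _ ≤ ∑ z : (Fin n × Fin d) × (Fin n × Fin d),
        (2 * (x z.1 * x z.1 * (y z.2 * y z.2)) + 2 * (y z.1 * y z.1 * (x z.2 * x z.2))) := by
        refine Finset.sum_le_sum fun z _ => ?_
        split_ifs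
        · nlinarith [sq_nonneg (x z.1 * y z.2 - x z.2 * y z.1)]
        · nlinarith [sq_nonneg (x z.1 * y z.2), sq_nonneg (x z.2 * y z.1)]
    _ = 4 * (x ⬝ᵥ x) * (y ⬝ᵥ y) := by
        rw [Finset.sum_add_distrib, ← Finset.mul_sum, ← Finset.mul_sum, Fintype.sum_prod_type'
          (f := fun q r : Fin n × Fin d => x q * x q * (y r * y r)), Fintype.sum_prod_type'
          (f := fun q r : Fin n × Fin d => y q * y q * (x r * x r))]
        simp only [← Finset.mul_sum, ← Finset.sum_mul, dotProduct]
        ring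

instance : IsProbabilityMeasure (gaussianEnsemble n d) := by
  unfold gaussianEnsemble
  infer_instance

lemma gaussianEnsemble_form_ge_le (x y : Fin n × Fin d → ℝ) {V t : ℝ} (hV : 0 < V)
    (hxy : 4 * (x ⬝ᵥ x) * (y ⬝ᵥ y) ≤ V) (ht : 0 ≤ t) :
    (gaussianEnsemble n d).real {ω | t ≤ x ⬝ᵥ Wof ω *ᵥ y} ≤ Real.exp (-t ^ 2 / (2 * V)) := by
  simp only [dotProduct_wof_mulVec]
  exact measure_pi_gaussianReal_sum_ge_le _ hV ((sum_wof_coeff_sq_le x y).trans hxy) ht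

/-- A union bound over nets for a Gaussian bilinear form in linearly parametrized vectors. -/
lemma gaussianEnsemble_exists_form_gt_le {ι κ : Type*} [Fintype ι] [Fintype κ]
    (P : Matrix (Fin n × Fin d) ι ℝ) (Q : Matrix (Fin n × Fin d) κ ℝ) {V s t : ℝ} (hV : 0 < V)
    (hPQ : ∀ a b, (P *ᵥ a) ⬝ᵥ (P *ᵥ a) * ((Q *ᵥ b) ⬝ᵥ (Q *ᵥ b)) ≤ V * (a ⬝ᵥ a) * (b ⬝ᵥ b))
    (ht : 0 ≤ t) (hs : s = Fintype.card ι + Fintype.card κ) :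
    (gaussianEnsemble n d).real
      {ω | ∃ a b, a ⬝ᵥ a ≤ 1 ∧ b ⬝ᵥ b ≤ 1 ∧ t < (P *ᵥ a) ⬝ᵥ Wof ω *ᵥ (Q *ᵥ b)} ≤
      Real.exp (3 * s - t ^ 2 / (128 * V)) := by
  have hsub : {ω : (Fin n × Fin d) × (Fin n × Fin d) → ℝ |
      ∃ a b, a ⬝ᵥ a ≤ 1 ∧ b ⬝ᵥ b ≤ 1 ∧ t < (P *ᵥ a) ⬝ᵥ Wof ω *ᵥ (Q *ᵥ b)} ⊆
      ⋃ z ∈ latticeNet ι ×ˢ latticeNet κ,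
        {ω | t ≤ (P *ᵥ netPoint ι z.1) ⬝ᵥ Wof ω *ᵥ (Q *ᵥ netPoint κ z.2)} := by
    rintro ω ⟨a, b, ha, hb, hab⟩
    obtain ⟨k, hk, hka⟩ := exists_dotProduct_le_netPoint ha (Pᵀ *ᵥ (Wof ω *ᵥ (Q *ᵥ b)))
    obtain ⟨l, hl, hlb⟩ := exists_dotProduct_le_netPoint hb
      (((P *ᵥ netPoint ι k) ᵥ* Wof ω) ᵥ* Q)
    simp only [Set.mem_iUnion, Set.mem_ofPred_eq]
    refine ⟨(k, l), Finset.mem_product.mpr ⟨hk, hl⟩, ?_⟩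
    simp only [← dotProduct_mulVec] at hlb
    rw [dotProduct_comm, dotProduct_transpose_mulVec_eq,
      dotProduct_comm _ (netPoint ι k), dotProduct_transpose_mulVec_eq] at hka
    linarith
  have htail : ∀ z ∈ latticeNet ι ×ˢ latticeNet κ, (gaussianEnsemble n d).real
      {ω | t ≤ (P *ᵥ netPoint ι z.1) ⬝ᵥ Wof ω *ᵥ (Q *ᵥ netPoint κ z.2)} ≤
      Real.exp (-t ^ 2 / (2 * (64 * V))) := fun z hz => by
    rw [Finset.mem_product] at hz
    have h1 := netPoint_dotProduct_self_le hz.1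
    have h2 := netPoint_dotProduct_self_le hz.2
    have h3 := hPQ (netPoint ι z.1) (netPoint κ z.2)
    have h4 : (netPoint ι z.1 ⬝ᵥ netPoint ι z.1) * (netPoint κ z.2 ⬝ᵥ netPoint κ z.2) ≤ 4 * 4 :=
      mul_le_mul h1 h2 (dotProduct_self_nonneg' _) (by norm_num)
    exact gaussianEnsemble_form_ge_le _ _ (by positivity) (by nlinarith) ht
  have h16 : (16 : ℝ) ≤ Real.exp 3 := by
    have h := Real.exp_one_gt_d9
    have : Real.exp 3 = Real.exp 1 ^ 3 := by rw [← Real.exp_nat_mul]; norm_num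
    rw [this]
    calc (16 : ℝ) ≤ 2.7 ^ 3 := by norm_num
      _ ≤ Real.exp 1 ^ 3 := pow_le_pow_left₀ (by norm_num) (by linarith) 3
  calc _ ≤ (gaussianEnsemble n d).real (⋃ z ∈ latticeNet ι ×ˢ latticeNet κ,
        {ω | t ≤ (P *ᵥ netPoint ι z.1) ⬝ᵥ Wof ω *ᵥ (Q *ᵥ netPoint κ z.2)}) := 
        measureReal_mono hsub (measure_ne_top _ _)
    _ ≤ ∑ z ∈ latticeNet ι ×ˢ latticeNet κ, (gaussianEnsemble n d).real
        {ω | t ≤ (P *ᵥ netPoint ι z.1) ⬝ᵥ Wof ω *ᵥ (Q *ᵥ netPoint κ z.2)} :=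
        measureReal_biUnion_finset_le _ _
    _ ≤ ∑ _z ∈ latticeNet ι ×ˢ latticeNet κ, Real.exp (-t ^ 2 / (2 * (64 * V))) :=
        Finset.sum_le_sum htail
    _ = (latticeNet ι).card * (latticeNet κ).card * Real.exp (-t ^ 2 / (2 * (64 * V))) := by
        simp [Finset.card_product]
    _ ≤ Real.exp 3 ^ Fintype.card ι * Real.exp 3 ^ Fintype.card κ *
        Real.exp (-t ^ 2 / (2 * (64 * V))) := by
        gcongr
        · exact (card_latticeNet_le ι).trans (pow_le_pow_left₀ (by norm_num) h16 _)
        · exact (card_latticeNet_le κ).trans (pow_le_pow_left₀ (by norm_num) h16 _)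
    _ = Real.exp (3 * s - t ^ 2 / (128 * V)) := by
        rw [← Real.exp_nat_mul, ← Real.exp_nat_mul, ← Real.exp_add, ← Real.exp_add, hs]
        congr 1
        ring

end GaussianForm

section GaussianNoise

variable {n d : ℕ}

lemma inv_vnorm_smul_dotProduct_self {ι : Type*} [Fintype ι] {x : ι → ℝ} (hx : 0 < vnorm x) :
    ((vnorm x)⁻¹ • x) ⬝ᵥ ((vnorm x)⁻¹ • x) = 1 := by
  rw [← vnorm_sq, vnorm_smul, abs_of_pos (inv_pos.mpr hx), inv_mul_cancel₀ hx.ne', one_pow]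

lemma le_mul_vnorm_of_le_on_ball {ι κ : Type*} [Fintype ι] [Fintype κ] (M : Matrix ι κ ℝ) {t : ℝ}
    (h : ∀ a b, a ⬝ᵥ a ≤ 1 → b ⬝ᵥ b ≤ 1 → a ⬝ᵥ M *ᵥ b ≤ t) (a : ι → ℝ) (b : κ → ℝ) :
    a ⬝ᵥ M *ᵥ b ≤ t * vnorm a * vnorm b := by
  rcases (vnorm_nonneg a).eq_or_lt with ha | ha
  · simp [eq_zero_of_vnorm ha.symm, vnorm]
  rcases (vnorm_nonneg b).eq_or_lt with hb | hb
  · simp [eq_zero_of_vnorm hb.symm, vnorm]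
  have := h _ _ (inv_vnorm_smul_dotProduct_self ha).le (inv_vnorm_smul_dotProduct_self hb).le
  rw [mulVec_smul, smul_dotProduct, dotProduct_smul, smul_eq_mul, smul_eq_mul, ← mul_assoc,
    ← mul_inv, inv_mul_le_iff₀ (mul_pos ha hb)] at this
  linarith

lemma wof_isSymm (ω : (Fin n × Fin d) × (Fin n × Fin d) → ℝ) : (Wof ω).IsSymm := by
  ext q r
  simp only [Matrix.transpose_apply, Wof]
  rcases lt_trichotomy q.1 r.1 with h | h | h
  · simp [h, h.asymm]
  · simp [h]
  · simp [h, h.asymm]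

lemma blk_smul_wof_self (σ : ℝ) (ω : (Fin n × Fin d) × (Fin n × Fin d) → ℝ) (i : Fin n) :
    blk (σ • Wof ω) i i = 0 := by
  ext k l
  simp [blk, Wof]

lemma StiefelBlocks.mulVec_dotProduct_self {G : Matrix (Fin n × Fin d) (Fin d) ℝ}
    (hG : StiefelBlocks G) (b : Fin d → ℝ) : (G *ᵥ b) ⬝ᵥ (G *ᵥ b) = n * (b ⬝ᵥ b) := by
  rw [dotProduct_eq_sum_vblk]
  simp only [vblk_mulVec, ← vnorm_sq, hG.vnorm_rowBlk_mulVec]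
  simp

/-- The matrix of `blockSingle i`. -/
def blockIncl (n d : ℕ) (i : Fin n) : Matrix (Fin n × Fin d) (Fin d) ℝ :=
  fun q l => if q = (i, l) then 1 else 0

lemma blockIncl_mulVec (i : Fin n) (v : Fin d → ℝ) :
    blockIncl n d i *ᵥ v = blockSingle i v := by
  ext ⟨j, k⟩
  by_cases h : j = i
  · subst h
    simp [mulVec, dotProduct, blockIncl, blockSingle]
  · simp [mulVec, dotProduct, blockIncl, blockSingle, h]

/-- Noise realizations for which the spectral norm is large. -/
def spectralBad (n d : ℕ) : Set ((Fin n × Fin d) × (Fin n × Fin d) → ℝ) :=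
  {ω | ∃ a b : Fin n × Fin d → ℝ, a ⬝ᵥ a ≤ 1 ∧ b ⬝ᵥ b ≤ 1 ∧
    40 * Real.sqrt (n * d) < (((1 : Matrix _ _ ℝ) *ᵥ a) ⬝ᵥ Wof ω *ᵥ ((1 : Matrix _ _ ℝ) *ᵥ b))}

/-- Noise realizations for which the `i`-th block of the noise applied to `G` is large. -/
def blockBad (G : Matrix (Fin n × Fin d) (Fin d) ℝ) (t : ℝ) (i : Fin n) :
    Set ((Fin n × Fin d) × (Fin n × Fin d) → ℝ) :=
  {ω | ∃ a b : Fin d → ℝ, a ⬝ᵥ a ≤ 1 ∧ b ⬝ᵥ b ≤ 1 ∧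
    t < (blockIncl n d i *ᵥ a) ⬝ᵥ Wof ω *ᵥ (G *ᵥ b)}

lemma exp_neg_le_inv_natCast (hn : 0 < n) : Real.exp (-n) ≤ 1 / (n : ℝ) := by
  rw [Real.exp_neg, ← one_div]
  exact one_div_le_one_div_of_le (by exact_mod_cast hn) (by linarith [Real.add_one_le_exp (n : ℝ)])

lemma measure_spectralBad_le (hn : 0 < n) (hd : 0 < d) :
    (gaussianEnsemble n d).real (spectralBad n d) ≤ 1 / n := by
  have h := gaussianEnsemble_exists_form_gt_le (n := n) (d := d) (ι := Fin n × Fin d)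
    (κ := Fin n × Fin d) 1 1 (V := 1) (s := 2 * (n * d)) (t := 40 * Real.sqrt (n * d)) one_pos
    (by simp) (by positivity) (by simp; ring)
  refine h.trans (le_trans (Real.exp_le_exp.mpr ?_) (exp_neg_le_inv_natCast hn))
  rw [mul_pow, Real.sq_sqrt (by positivity)]
  have : (1 : ℝ) ≤ d := by exact_mod_cast hd
  have : (n : ℝ) * 1 ≤ n * d := by gcongr
  linarith

lemma measure_blockBad_le {G : Matrix (Fin n × Fin d) (Fin d) ℝ} (hG : StiefelBlocks G)
    (hn : 0 < n) (hd : 0 < d) {σ : ℝ} (hσ : 0 < σ) (h : 10 ^ 6 * (σ ^ 2 * d) ≤ Real.sqrt n)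
    (i : Fin n) :
    (gaussianEnsemble n d).real (blockBad G (n / (20 * σ)) i) ≤ 1 / n ^ 2 := by
  have hn' : (0 : ℝ) < n := by exact_mod_cast hn
  have hd' : (1 : ℝ) ≤ d := by exact_mod_cast hd
  have hP := gaussianEnsemble_exists_form_gt_le (n := n) (d := d) (blockIncl n d i) G
    (V := n) (s := 2 * d) (t := n / (20 * σ)) hn' (fun a b => by
      rw [blockIncl_mulVec, hG.mulVec_dotProduct_self, ← vnorm_sq (blockSingle i a),
        vnorm_blockSingle, vnorm_sq]
      exact le_of_eq (by ring)) (by positivity) (by simp; ring)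
  set r := Real.sqrt n with hr
  have hrr : r ^ 2 = n := Real.sq_sqrt hn'.le
  have hr1 : 1 ≤ r := by
    rw [hr, Real.one_le_sqrt]
    exact_mod_cast hn
  have hexp : (n : ℝ) ^ 2 ≤ Real.exp (4 * r) := by
    have h1 : r ≤ Real.exp r := by linarith [Real.add_one_le_exp r]
    have h2 : Real.exp (4 * r) = Real.exp r ^ 4 := by rw [← Real.exp_nat_mul]; norm_num
    rw [h2, ← hrr, ← pow_mul]
    exact pow_le_pow_left₀ (by linarith) h1 _
  have hmain : 3 * (2 * d) - (n / (20 * σ)) ^ 2 / (128 * n) ≤ -(4 * r) := by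
    have h1 : (n / (20 * σ)) ^ 2 / (128 * n) = n / (51200 * σ ^ 2) := by
      field_simp
      norm_num
    have h2 : 10 * (r * d) ≤ n / (51200 * σ ^ 2) := by
      rw [le_div_iff₀ (by positivity), ← hrr]
      nlinarith
    rw [h1]
    nlinarith
  calc _ ≤ _ := hP
    _ ≤ Real.exp (-(4 * r)) := Real.exp_le_exp.mpr hmain
    _ ≤ 1 / n ^ 2 := by
        rw [Real.exp_neg, ← one_div]
        exact one_div_le_one_div_of_le (by positivity) hexp

lemma noiseBound_of_not_bad {G : Matrix (Fin n × Fin d) (Fin d) ℝ} {σ : ℝ} (hσ : 0 < σ)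
    (hn : 0 < n) (hd : 0 < d) (hreg : (10 ^ 7 * σ ^ 2) ^ 2 * (d : ℝ) ^ 3 ≤ n)
    {ω : (Fin n × Fin d) × (Fin n × Fin d) → ℝ} (h1 : ω ∉ spectralBad n d)
    (h2 : ∀ i, ω ∉ blockBad G (n / (20 * σ)) i) :
    NoiseBound G (σ • Wof ω) (40 * σ * Real.sqrt (n * d)) := by
  have hn' : (1 : ℝ) ≤ n := by exact_mod_cast hn
  have hd' : (1 : ℝ) ≤ d := by exact_mod_cast hd
  have hs0 : (0 : ℝ) ≤ Real.sqrt (n * d) := Real.sqrt_nonneg _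
  have hss : Real.sqrt (n * d) ^ 2 = (n * d : ℝ) := Real.sq_sqrt (by positivity)
  have hδ2 : (40 * σ * Real.sqrt (n * d)) ^ 2 = 1600 * σ ^ 2 * (n * d) := by
    rw [mul_pow, hss]
    ring
  have hδ4 : (40 * σ * Real.sqrt (n * d)) ^ 4 = (1600 * σ ^ 2 * (n * d)) ^ 2 := by
    rw [← hδ2]
    ring
  have hτ : (0 : ℝ) ≤ 10 ^ 7 * σ ^ 2 := by positivity
  have hd3 : (d : ℝ) ^ 2 ≤ d ^ 3 := pow_le_pow_right₀ hd' (by norm_num)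
  refine ⟨(wof_isSymm ω).smul σ, blk_smul_wof_self σ ω, by positivity, fun x y => ?_, ?_,
    fun i v b => ?_, ?_⟩
  · have := le_mul_vnorm_of_le_on_ball (Wof ω) (t := 40 * Real.sqrt (n * d)) (fun a b ha hb => by
      by_contra! hc
      exact h1 ⟨a, b, ha, hb, by simpa using hc⟩) x y
    rw [smul_mulVec, dotProduct_smul, smul_eq_mul]
    calc _ ≤ σ * (40 * Real.sqrt (n * d) * vnorm x * vnorm y) :=
          mul_le_mul_of_nonneg_left this hσ.le
      _ = _ := by ring
  · refine abs_le_of_sq_le_sq' (?_ : _ ≤ (n / 20 : ℝ) ^ 2) (by positivity) |>.2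
    rw [hδ2]
    have : 10 ^ 7 * σ ^ 2 * d ≤ n := by
      refine abs_le_of_sq_le_sq' ?_ (by positivity) |>.2
      nlinarith [sq_nonneg (10 ^ 7 * σ ^ 2)]
    nlinarith
  · have := le_mul_vnorm_of_le_on_ball ((blockIncl n d i)ᵀ * Wof ω * G) (t := n / (20 * σ))
      (fun a b ha hb => by
        by_contra! hc
        refine h2 i ⟨a, b, ha, hb, hc.trans_eq ?_⟩
        rw [← mulVec_mulVec, ← mulVec_mulVec, dotProduct_transpose_mulVec_eq]) v b
    rw [← mulVec_mulVec, ← mulVec_mulVec, dotProduct_transpose_mulVec_eq, blockIncl_mulVec] at this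
    rw [smul_mulVec, dotProduct_smul, smul_eq_mul]
    calc _ ≤ σ * (n / (20 * σ) * vnorm v * vnorm b) := mul_le_mul_of_nonneg_left this hσ.le
      _ = _ := by field_simp
  · rw [hδ2, hδ4]
    rcases le_total (n : ℝ) d with hnd | hnd
    · left
      have : 10 ^ 7 * σ ^ 2 * d ≤ 1 := by
        refine abs_le_of_sq_le_sq' ?_ zero_le_one |>.2
        have h3 : (10 ^ 7 * σ ^ 2 * d) ^ 2 * d ≤ 1 * d := by nlinarith
        rw [one_pow]
        exact le_of_mul_le_mul_right h3 (by linarith)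
      nlinarith
    · right
      constructor
      · have : 10 ^ 7 * σ ^ 2 * d ^ 2 ≤ n := by
          refine abs_le_of_sq_le_sq' ?_ (by linarith) |>.2
          calc (10 ^ 7 * σ ^ 2 * (d : ℝ) ^ 2) ^ 2
              = (10 ^ 7 * σ ^ 2) ^ 2 * (d : ℝ) ^ 3 * (d : ℝ) := by ring
            _ ≤ (n : ℝ) * n := mul_le_mul hreg hnd (by linarith) (by linarith)
            _ = (n : ℝ) ^ 2 := by ring
        nlinarith
      · have h3 := mul_le_mul_of_nonneg_left hreg (sq_nonneg (n : ℝ))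
        have h4 : (0 : ℝ) ≤ (n : ℝ) ^ 3 := by positivity
        nlinarith

lemma pow_four_le_of_le {p : ℕ} (hd : 0 < d) {σ C : ℝ} (hσ : 0 < σ)
    (hC : 0 ≤ C)
    (h : σ ≤ C * Real.sqrt (((p : ℝ) - 2 * d) / ((p : ℝ) + d)) *
      (n : ℝ) ^ ((1 : ℝ) / 4) * (d : ℝ) ^ (-(3 : ℝ) / 4)) :
    σ ^ 4 * (d : ℝ) ^ 3 ≤ C ^ 4 * n := by
  have hd' : (0 : ℝ) < d := by exact_mod_cast hd
  have hsq : Real.sqrt (((p : ℝ) - 2 * d) / ((p : ℝ) + d)) ≤ 1 := by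
    rw [Real.sqrt_le_one]
    exact div_le_one_of_le₀ (by linarith) (by positivity)
  have hle : σ ≤ C * (n : ℝ) ^ ((1 : ℝ) / 4) * (d : ℝ) ^ (-(3 : ℝ) / 4) := by
    refine h.trans ?_
    gcongr
    exact mul_le_of_le_one_right hC hsq
  have h4 := pow_le_pow_left₀ hσ.le hle 4
  rw [mul_pow, mul_pow, ← Real.rpow_natCast ((n : ℝ) ^ _), ← Real.rpow_natCast ((d : ℝ) ^ _),
    ← Real.rpow_mul (Nat.cast_nonneg _), ← Real.rpow_mul hd'.le] at h4
  norm_num at h4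
  rw [← div_eq_mul_inv, le_div_iff₀ (by positivity)] at h4
  exact h4

end GaussianNoise

/-- benign Burer–Monteiro landscape under Gaussian noise. -/
theorem bm_landscape_gaussian :
    ∃ C₀ > (0 : ℝ), ∃ c > (0 : ℝ), ∀ (n d p : ℕ), 2 ≤ n → 1 ≤ d → 2 * d + 1 ≤ p →
      ∀ σ : ℝ, 0 < σ →
      σ ≤ C₀ * Real.sqrt (((p : ℝ) - 2 * d) / ((p : ℝ) + d)) *
            (n : ℝ) ^ ((1 : ℝ) / 4) * (d : ℝ) ^ (-(3 : ℝ) / 4) →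
      ∀ G : Matrix (Fin n × Fin d) (Fin d) ℝ, StiefelBlocks G →
        ENNReal.ofReal (1 - c / n) ≤
          gaussianEnsemble n d
            {ω | ∃ X : Matrix (Fin n × Fin d) (Fin n × Fin d) ℝ,
              sdpMaximizer (G * Gᵀ + σ • Wof ω) X ∧
              (∀ Y, sdpMaximizer (G * Gᵀ + σ • Wof ω) Y → Y = X) ∧
              X.rank = d ∧
              (∃ R : Matrix (Fin n × Fin d) (Fin d) ℝ,
                progPMaximizer (G * Gᵀ + σ • Wof ω) R ∧ X = R * Rᵀ) ∧
              ∀ S : Matrix (Fin n × Fin d) (Fin p) ℝ,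
                isLocalMax (G * Gᵀ + σ • Wof ω) S → S * Sᵀ = X} := by
  refine ⟨1 / 10000, by norm_num, 2, by norm_num, fun n d p hn hd hp σ hσ hle G hG => ?_⟩
  have hn0 : 0 < n := by omega
  have hn' : (0 : ℝ) < n := by exact_mod_cast hn0
  have hd' : (1 : ℝ) ≤ d := by exact_mod_cast hd
  have hreg : (10 ^ 7 * σ ^ 2) ^ 2 * (d : ℝ) ^ 3 ≤ n := by
    have := pow_four_le_of_le hd hσ (by norm_num) hle
    nlinarith
  have hsqrt : 10 ^ 6 * (σ ^ 2 * d) ≤ Real.sqrt n := by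
    refine Real.le_sqrt_of_sq_le (le_trans ?_ hreg)
    have h2 : (d : ℝ) ^ 2 ≤ d ^ 3 := pow_le_pow_right₀ hd' (by norm_num)
    have h3 := mul_le_mul_of_nonneg_left h2 (sq_nonneg (σ ^ 2))
    have h4 : (0 : ℝ) ≤ (σ ^ 2) ^ 2 * d ^ 3 := by positivity
    nlinarith
  set good := {ω | ∃ X : Matrix (Fin n × Fin d) (Fin n × Fin d) ℝ,
    sdpMaximizer (G * Gᵀ + σ • Wof ω) X ∧
    (∀ Y, sdpMaximizer (G * Gᵀ + σ • Wof ω) Y → Y = X) ∧ X.rank = d ∧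
    (∃ R : Matrix (Fin n × Fin d) (Fin d) ℝ,
      progPMaximizer (G * Gᵀ + σ • Wof ω) R ∧ X = R * Rᵀ) ∧
    ∀ S : Matrix (Fin n × Fin d) (Fin p) ℝ,
      isLocalMax (G * Gᵀ + σ • Wof ω) S → S * Sᵀ = X}
  set bad := ⋃ i ∈ (Finset.univ : Finset (Fin n)), blockBad G (n / (20 * σ)) i with hbad
  have hcover : Set.univ ⊆ good ∪ (spectralBad n d ∪ bad) := fun ω _ => by
    by_contra hω
    simp only [Set.mem_union, not_or, hbad, Set.mem_iUnion, not_exists] at hω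
    exact hω.1 ((noiseBound_of_not_bad hσ hn0 hd hreg hω.2.1 fun i =>
      hω.2.2 i (Finset.mem_univ i)).landscape hG hn0 hp)
  have hbadle : (gaussianEnsemble n d).real bad ≤ 1 / n :=
    calc _ ≤ ∑ i, (gaussianEnsemble n d).real (blockBad G (n / (20 * σ)) i) :=
          measureReal_biUnion_finset_le _ _
      _ ≤ ∑ _i : Fin n, 1 / (n : ℝ) ^ 2 :=
          Finset.sum_le_sum fun i _ => measure_blockBad_le hG hn0 hd hσ hsqrt i
      _ = 1 / n := by
          rw [Finset.sum_const, Finset.card_univ, Fintype.card_fin, nsmul_eq_mul]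
          field_simp
  have hreal : 1 - 2 / (n : ℝ) ≤ (gaussianEnsemble n d).real good := by
    have h1 := measureReal_mono (μ := gaussianEnsemble n d) hcover (measure_ne_top _ _)
    have h2 := measureReal_union_le (μ := gaussianEnsemble n d) good (spectralBad n d ∪ bad)
    have h3 := measureReal_union_le (μ := gaussianEnsemble n d) (spectralBad n d) bad
    have h4 := measure_spectralBad_le (n := n) (d := d) hn0 hd
    rw [probReal_univ] at h1
    have h5 : 2 / (n : ℝ) = 1 / n + 1 / n := by ring
    linarith
  exact ENNReal.ofReal_le_of_le_toReal hreal
end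
end

section
/- Suppose p ≥ d + 1 and A_{ii} = I_d for all i. If S ∈ St(d,p)^{⊗n} is a local maximizer of f, then Λ_{ii}(S) − I_d is positive semidefinite for every i ∈ {1,…,n}; in particular each Λ_{ii}(S) is positive semidefinite. -/
open Matrix MeasureTheory ProbabilityTheory
open scoped BigOperators ENNReal

noncomputable section

lemma dotProduct_self_pos {k : Type*} [Fintype k] {x : k → ℝ} (hx : x ≠ 0) : 0 < x ⬝ᵥ x :=
  (dotProduct_self_star_nonneg x).lt_of_ne' (mt dotProduct_self_eq_zero.1 hx)

lemma smul_inv_sqrt_dotProduct_self {k : Type*} [Fintype k] {x : k → ℝ} (hx : x ≠ 0) :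
    (√(x ⬝ᵥ x))⁻¹ • x ⬝ᵥ (√(x ⬝ᵥ x))⁻¹ • x = 1 := by
  have h := dotProduct_self_pos hx
  rw [smul_dotProduct, dotProduct_smul, smul_eq_mul, smul_eq_mul, ← mul_assoc, ← mul_inv,
    Real.mul_self_sqrt h.le, inv_mul_cancel₀ h.ne']

/-- A wide real matrix kills a unit vector. -/
lemma exists_unit_mulVec_eq_zero {d p : ℕ} (hp : d < p) (R : Matrix (Fin d) (Fin p) ℝ) :
    ∃ w : Fin p → ℝ, w ⬝ᵥ w = 1 ∧ R *ᵥ w = 0 := by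
  obtain ⟨x, hx, hx0⟩ := Submodule.exists_mem_ne_zero_of_ne_bot
    (LinearMap.ker_ne_bot_of_finrank_lt (f := R.mulVecLin) (by simpa using hp))
  refine ⟨_, smul_inv_sqrt_dotProduct_self hx0, ?_⟩
  rw [mulVec_smul, ← mulVecLin_apply, LinearMap.mem_ker.1 hx, smul_zero]

/-- A vector in `ℝ^d` placed in the `i`-th block of `ℝ^{nd}`. -/
def blkVec {n d : ℕ} (i : Fin n) (u : Fin d → ℝ) : Fin n × Fin d → ℝ :=
  fun q => if q.1 = i then u q.2 else 0

lemma blkVec_dotProduct {n d : ℕ} (i : Fin n) (u : Fin d → ℝ) (x : Fin n × Fin d → ℝ) :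
    blkVec i u ⬝ᵥ x = u ⬝ᵥ fun k => x (i, k) := by
  simp [dotProduct, blkVec, Fintype.sum_prod_type, Finset.sum_ite_eq']

lemma transpose_mulVec_blkVec {n d p : ℕ} (S : Matrix (Fin n × Fin d) (Fin p) ℝ) (i : Fin n)
    (u : Fin d → ℝ) : Sᵀ *ᵥ blkVec i u = (rowBlk S i)ᵀ *ᵥ u := by
  ext l
  rw [mulVec, dotProduct_comm, blkVec_dotProduct, dotProduct_comm]
  rfl

lemma blkVec_dotProduct_mulVec {n d : ℕ} (M : Matrix (Fin n × Fin d) (Fin n × Fin d) ℝ)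
    (i : Fin n) (u : Fin d → ℝ) :
    blkVec i u ⬝ᵥ M *ᵥ blkVec i u = u ⬝ᵥ blk M i i *ᵥ u := by
  rw [blkVec_dotProduct]
  congr 1
  ext k
  rw [mulVec, dotProduct_comm, blkVec_dotProduct, dotProduct_comm]
  rfl

lemma rowBlk_add_vecMulVec {n d p : ℕ} (S : Matrix (Fin n × Fin d) (Fin p) ℝ) (i k : Fin n)
    (u : Fin d → ℝ) (v : Fin p → ℝ) :
    rowBlk (S + vecMulVec (blkVec i u) v) k =
      if k = i then rowBlk S i + vecMulVec u v else rowBlk S k := by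
  ext a l
  by_cases h : k = i
  · subst h
    simp [rowBlk, vecMulVec_apply, blkVec]
  · simp [rowBlk, vecMulVec_apply, blkVec, h]

/-- A rank-one update that preserves orthonormality of the rows. -/
lemma add_vecMulVec_mul_transpose {d p : ℕ} {R : Matrix (Fin d) (Fin p) ℝ} (hR : R * Rᵀ = 1)
    {u : Fin d → ℝ} {v : Fin p → ℝ} {δ : ℝ} (hRv : R *ᵥ v = -δ • u) (hv : v ⬝ᵥ v = 2 * δ) :
    (R + vecMulVec u v) * (R + vecMulVec u v)ᵀ = 1 := by
  rw [transpose_add, transpose_vecMulVec, Matrix.add_mul, Matrix.mul_add, Matrix.mul_add, hR,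
    mul_vecMulVec, vecMulVec_mul, vecMul_transpose, hRv, vecMulVec_mul_vecMulVec, hv]
  ext a b
  simp [vecMulVec_apply]
  ring

lemma finner_mul_transpose_add_vecMulVec {m k : Type*} [Fintype m] [Fintype k]
    {A : Matrix m m ℝ} (hA : A.IsSymm) (S : Matrix m k ℝ) (x : m → ℝ) (v : k → ℝ) :
    finner A ((S + vecMulVec x v) * (S + vecMulVec x v)ᵀ) =
      finner A (S * Sᵀ) + 2 * (x ⬝ᵥ A *ᵥ S *ᵥ v) + (v ⬝ᵥ v) * (x ⬝ᵥ A *ᵥ x) := by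
  have hadd (X Y : Matrix m m ℝ) : finner A (X + Y) = finner A X + finner A Y := by
    simp [finner, mul_add, Finset.sum_add_distrib]
  have hvec (y z : m → ℝ) : finner A (vecMulVec y z) = y ⬝ᵥ A *ᵥ z := by
    simp only [finner, vecMulVec_apply, dotProduct, mulVec, Finset.mul_sum]
    exact Finset.sum_congr rfl fun _ _ => Finset.sum_congr rfl fun _ _ => by ring
  have hsymm (y z : m → ℝ) : y ⬝ᵥ A *ᵥ z = z ⬝ᵥ A *ᵥ y := by
    rw [dotProduct_mulVec, ← mulVec_transpose, hA.eq, dotProduct_comm]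
  rw [transpose_add, transpose_vecMulVec, Matrix.add_mul, Matrix.mul_add, Matrix.mul_add,
    mul_vecMulVec, vecMulVec_mul, vecMul_transpose, vecMulVec_mul_vecMulVec, hadd, hadd, hadd,
    hvec, hvec, hvec, hsymm (S *ᵥ v) x]
  simp only [mulVec_smul, dotProduct_smul, smul_eq_mul]
  ring

lemma frobNorm_vecMulVec {m k : Type*} [Fintype m] [Fintype k] (x : m → ℝ) (v : k → ℝ) :
    frobNorm (vecMulVec x v) = Real.sqrt ((x ⬝ᵥ x) * (v ⬝ᵥ v)) := by
  simp only [frobNorm, vecMulVec_apply, dotProduct, Finset.sum_mul_sum]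
  congr 1
  exact Finset.sum_congr rfl fun _ _ => Finset.sum_congr rfl fun _ _ => by ring

lemma Lam_eq_blk {n d p : ℕ} {A : Matrix (Fin n × Fin d) (Fin n × Fin d) ℝ} (hA : A.IsSymm)
    (S : Matrix (Fin n × Fin d) (Fin p) ℝ) (i : Fin n) :
    Lam A S i = (1 / 2 : ℝ) • ((blk (A * S * Sᵀ) i i)ᵀ + blk (A * S * Sᵀ) i i) := by
  have hblk : blk (A * S * Sᵀ) i i = ∑ j, blk A i j * rowBlk S j * (rowBlk S i)ᵀ := by
    rw [← Matrix.sum_mul]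
    ext a b
    simp only [blk, mul_apply, Matrix.sum_apply, Fintype.sum_prod_type, rowBlk, transpose_apply]
  have hAt (j : Fin n) : (blk A i j)ᵀ = blk A j i := by
    ext a b
    exact hA.apply _ _
  rw [Lam, Finset.sum_add_distrib, hblk, transpose_sum]
  simp only [transpose_mul, transpose_transpose, hAt, Matrix.mul_assoc]

lemma dotProduct_Lam_mulVec {n d p : ℕ} {A : Matrix (Fin n × Fin d) (Fin n × Fin d) ℝ}
    (hA : A.IsSymm) (S : Matrix (Fin n × Fin d) (Fin p) ℝ) (i : Fin n) (u : Fin d → ℝ) :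
    u ⬝ᵥ Lam A S i *ᵥ u = blkVec i u ⬝ᵥ A *ᵥ S *ᵥ (rowBlk S i)ᵀ *ᵥ u := by
  have ht : u ⬝ᵥ (blk (A * S * Sᵀ) i i)ᵀ *ᵥ u = u ⬝ᵥ blk (A * S * Sᵀ) i i *ᵥ u := by
    rw [mulVec_transpose, dotProduct_comm, dotProduct_mulVec]
  rw [Lam_eq_blk hA, smul_mulVec, add_mulVec, dotProduct_smul, dotProduct_add, ht,
    ← blkVec_dotProduct_mulVec, ← transpose_mulVec_blkVec]
  simp only [mulVec_mulVec, Matrix.mul_assoc, smul_eq_mul]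
  ring

/-- At a local maximizer the quadratic form of `Λ_{ii}(S)` is at least one on unit vectors. -/
lemma isLocalMax.one_le_dotProduct_Lam {n d p : ℕ} (hp : d < p)
    {A : Matrix (Fin n × Fin d) (Fin n × Fin d) ℝ} (hA : A.IsSymm)
    {S : Matrix (Fin n × Fin d) (Fin p) ℝ} (hS : isLocalMax A S) {i : Fin n}
    (hAi : blk A i i = 1) {u : Fin d → ℝ} (hu : u ⬝ᵥ u = 1) :
    1 ≤ u ⬝ᵥ Lam A S i *ᵥ u := by
  obtain ⟨hSt, ε, hε, hmax⟩ := hS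
  set R := rowBlk S i
  obtain ⟨w, hw, hRw⟩ := exists_unit_mulVec_eq_zero hp R
  obtain ⟨δ, hδ, hδε⟩ : ∃ δ > (0 : ℝ), δ ≤ 1 ∧ 2 * δ < ε ^ 2 :=
    ⟨min 1 (ε ^ 2 / 4), by positivity, min_le_left _ _, by
      have := min_le_right 1 (ε ^ 2 / 4)
      have : 0 < ε ^ 2 := by positivity
      linarith⟩
  have hRu : (Rᵀ *ᵥ u) ⬝ᵥ (Rᵀ *ᵥ u) = 1 := by
    rw [dotProduct_mulVec, vecMul_transpose, mulVec_mulVec, hSt i, one_mulVec, hu]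
  have hwR : w ⬝ᵥ (Rᵀ *ᵥ u) = 0 := by
    rw [dotProduct_mulVec, vecMul_transpose, hRw, zero_dotProduct]
  have key (s : ℝ) (hs : s ^ 2 = 2 * δ - δ ^ 2) :
      -δ * (u ⬝ᵥ Lam A S i *ᵥ u) + s * (blkVec i u ⬝ᵥ A *ᵥ S *ᵥ w) + δ ≤ 0 := by
    set v := -δ • (Rᵀ *ᵥ u) + s • w with hv
    have hvv : v ⬝ᵥ v = 2 * δ := by
      simp only [hv, dotProduct_add, add_dotProduct, smul_dotProduct, dotProduct_smul, hRu, hw,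
        hwR, dotProduct_comm (Rᵀ *ᵥ u) w, smul_eq_mul]
      linarith
    have hRv : R *ᵥ v = -δ • u := by
      rw [hv, mulVec_add, mulVec_smul, mulVec_smul, hRw, mulVec_mulVec, hSt i, one_mulVec,
        smul_zero, add_zero]
    have hle := hmax (S + vecMulVec (blkVec i u) v)
      (fun k => by
        rw [rowBlk_add_vecMulVec]
        split_ifs
        · exact add_vecMulVec_mul_transpose (hSt i) hRv hvv
        · exact hSt k)
      (by
        rw [add_sub_cancel_left, frobNorm_vecMulVec, hvv, blkVec_dotProduct, Real.sqrt_lt' hε]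
        simpa [blkVec, hu] using hδε.2)
    rw [finner_mul_transpose_add_vecMulVec hA, hvv, blkVec_dotProduct_mulVec, hAi, one_mulVec,
      hu, hv, mulVec_add, mulVec_smul, mulVec_smul, mulVec_add, mulVec_smul, mulVec_smul,
      dotProduct_add, dotProduct_smul, dotProduct_smul, ← dotProduct_Lam_mulVec hA] at hle
    simp only [smul_eq_mul] at hle
    linarith
  have hs : 0 ≤ 2 * δ - δ ^ 2 := by nlinarith [hδε.1]
  have h₁ := key (Real.sqrt (2 * δ - δ ^ 2)) (Real.sq_sqrt hs)
  have h₂ := key (-Real.sqrt (2 * δ - δ ^ 2)) (by rw [neg_sq, Real.sq_sqrt hs])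
  nlinarith

lemma Lam_isHermitian {n d p : ℕ} {A : Matrix (Fin n × Fin d) (Fin n × Fin d) ℝ}
    (hA : A.IsSymm) (S : Matrix (Fin n × Fin d) (Fin p) ℝ) (i : Fin n) :
    (Lam A S i).IsHermitian := by
  rw [IsHermitian, conjTranspose_eq_transpose_of_trivial, Lam_eq_blk hA, transpose_smul,
    transpose_add, transpose_transpose, add_comm]

/-- `Λ_{ii}(S) ⪰ I_d` at local maximizers when `p ≥ d + 1` (Lemma 5.4). -/
theorem local_max_Lam_psd {n d p : ℕ} (hn : 2 ≤ n) (hd : 1 ≤ d) (hp : d + 1 ≤ p)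
    (A : Matrix (Fin n × Fin d) (Fin n × Fin d) ℝ) (hAsym : A.IsSymm)
    (hAdiag : ∀ i, blk A i i = 1)
    (S : Matrix (Fin n × Fin d) (Fin p) ℝ) (hS : isLocalMax A S) :
    ∀ i, (Lam A S i - 1).PosSemidef ∧ (Lam A S i).PosSemidef := by
  intro i
  have hpsd : (Lam A S i - 1).PosSemidef := by
    refine PosSemidef.of_dotProduct_mulVec_nonneg
      ((Lam_isHermitian hAsym S i).sub isHermitian_one) fun x => ?_
    rw [star_trivial, sub_mulVec, one_mulVec, dotProduct_sub, sub_nonneg]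
    rcases eq_or_ne x 0 with rfl | hx
    · simp
    have hxx : 0 < x ⬝ᵥ x := dotProduct_self_pos hx
    have h := hS.one_le_dotProduct_Lam hp hAsym (hAdiag i) (smul_inv_sqrt_dotProduct_self hx)
    rw [mulVec_smul, smul_dotProduct, dotProduct_smul, smul_eq_mul, smul_eq_mul, ← mul_assoc,
      ← mul_inv, Real.mul_self_sqrt hxx.le, inv_mul_eq_div, le_div_iff₀ hxx, one_mul] at h
    exact h
  exact ⟨hpsd, by simpa using hpsd.add PosSemidef.one⟩
end
end

section
/- Let δ > 0 and suppose S ∈ St(d,p)^{⊗n} satisfies the proximity condition d_F(S,Z) ≤ δ√(d/n)·‖Δ‖_op. Then every singular value σ of the d×p matrix ZᵀS = Σ_{j=1}^n S_j satisfies n − δ²d‖Δ‖_op²/(2n) ≤ σ ≤ n. -/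
open Matrix MeasureTheory ProbabilityTheory
open scoped BigOperators ENNReal

noncomputable section

/-- The transpose of a matrix with orthonormal rows preserves the Euclidean norm. -/
lemma norm_transpose_mulVec_of_mul_transpose_eq_one {d p : ℕ} {Q : Matrix (Fin d) (Fin p) ℝ}
    (hQ : Q * Qᵀ = 1) (u : EuclideanSpace ℝ (Fin d)) :
    ‖WithLp.toLp 2 (Qᵀ *ᵥ u.ofLp)‖ = ‖u‖ := by
  rw [← sq_eq_sq₀ (norm_nonneg _) (norm_nonneg _), ← real_inner_self_eq_norm_sq,
    ← real_inner_self_eq_norm_sq, EuclideanSpace.inner_eq_star_dotProduct,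
    EuclideanSpace.inner_eq_star_dotProduct]
  simp only [star_trivial]
  rw [Matrix.dotProduct_mulVec, Matrix.vecMul_transpose, Matrix.mulVec_mulVec, hQ,
    Matrix.one_mulVec]

/-- A singular value is the norm of the image of the corresponding left singular vector. -/
lemma singVals_eq_norm {d p : ℕ} (M : Matrix (Fin d) (Fin p) ℝ) (i : Fin d) :
    singVals M i = ‖WithLp.toLp 2
      (Mᵀ *ᵥ ((isHermitian_mul_conjTranspose_self M).eigenvectorBasis i).ofLp)‖ := by
  set hM := isHermitian_mul_conjTranspose_self M
  set u := hM.eigenvectorBasis i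
  have hnorm : ‖WithLp.toLp 2 (Mᵀ *ᵥ u.ofLp)‖ ^ 2 = hM.eigenvalues i := by
    have h1 : u.ofLp ⬝ᵥ u.ofLp = 1 := by
      have h : inner ℝ u u = 1 := by
        rw [real_inner_self_eq_norm_sq, hM.eigenvectorBasis.norm_eq_one, one_pow]
      rwa [EuclideanSpace.inner_eq_star_dotProduct, star_trivial] at h
    rw [← real_inner_self_eq_norm_sq, EuclideanSpace.inner_eq_star_dotProduct]
    simp only [star_trivial]
    have h2 : (M * Mᵀ) *ᵥ u.ofLp = hM.eigenvalues i • u.ofLp := by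
      rw [← Matrix.conjTranspose_eq_transpose_of_trivial M]
      exact hM.mulVec_eigenvectorBasis i
    rw [Matrix.dotProduct_mulVec, Matrix.vecMul_transpose, Matrix.mulVec_mulVec, h2,
      smul_dotProduct, h1, smul_eq_mul, mul_one]
  rw [singVals, ← hnorm, Real.sqrt_sq (norm_nonneg _)]

/-- The trace pairing of `M` with a matrix with orthonormal rows is at most the nuclear norm. -/
lemma trace_mul_transpose_le_nuclearNorm {d p : ℕ} (M : Matrix (Fin d) (Fin p) ℝ)
    {Q : Matrix (Fin d) (Fin p) ℝ} (hQ : Q * Qᵀ = 1) :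
    (M * Qᵀ).trace ≤ nuclearNorm M := by
  set b := (isHermitian_mul_conjTranspose_self M).eigenvectorBasis
  have htr : (M * Qᵀ).trace = ∑ i, inner ℝ (b i) (toLpLin 2 2 (M * Qᵀ) (b i)) := by
    rw [← LinearMap.trace_eq_sum_inner, toLpLin_eq_toLin, Matrix.trace_toLin_eq]
  rw [htr, nuclearNorm]
  refine Finset.sum_le_sum fun i _ => ?_
  have hinner : inner ℝ (b i) (toLpLin 2 2 (M * Qᵀ) (b i)) =
      inner ℝ (WithLp.toLp 2 (Mᵀ *ᵥ (b i).ofLp)) (WithLp.toLp 2 (Qᵀ *ᵥ (b i).ofLp)) := by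
    rw [EuclideanSpace.inner_eq_star_dotProduct, EuclideanSpace.inner_eq_star_dotProduct]
    simp only [star_trivial, toLpLin_apply]
    rw [Matrix.dotProduct_mulVec, Matrix.vecMul_transpose, Matrix.mulVec_mulVec]
  rw [hinner, singVals_eq_norm]
  refine (real_inner_le_norm _ _).trans_eq ?_
  rw [norm_transpose_mulVec_of_mul_transpose_eq_one hQ, b.norm_eq_one, mul_one]

lemma Zmat_transpose_mul {n d p : ℕ} (S : Matrix (Fin n × Fin d) (Fin p) ℝ) :
    (Zmat n d)ᵀ * S = ∑ j, rowBlk S j := by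
  ext k l
  simp [Matrix.mul_apply, Matrix.sum_apply, Zmat, rowBlk, Fintype.sum_prod_type]

/-- Each singular value of a sum of `n` Stiefel blocks is at most `n`. -/
lemma singVals_Zmat_transpose_mul_le {n d p : ℕ} {S : Matrix (Fin n × Fin d) (Fin p) ℝ}
    (hS : StiefelBlocks S) (i : Fin d) : singVals ((Zmat n d)ᵀ * S) i ≤ n := by
  rw [singVals_eq_norm]
  set b := (isHermitian_mul_conjTranspose_self ((Zmat n d)ᵀ * S)).eigenvectorBasis
  have hsum : WithLp.toLp 2 (((Zmat n d)ᵀ * S)ᵀ *ᵥ (b i).ofLp) =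
      ∑ j, WithLp.toLp 2 ((rowBlk S j)ᵀ *ᵥ (b i).ofLp) := by
    rw [Zmat_transpose_mul, Matrix.transpose_sum, Matrix.sum_mulVec, WithLp.toLp_sum]
  rw [hsum]
  refine (norm_sum_le _ _).trans_eq ?_
  simp [norm_transpose_mulVec_of_mul_transpose_eq_one (hS _)]

lemma sum_sum_sq_eq_trace {m k : Type*} [Fintype m] [Fintype k] (X : Matrix m k ℝ) :
    ∑ i, ∑ j, X i j ^ 2 = (X * Xᵀ).trace := by
  simp [Matrix.trace, Matrix.mul_apply, sq]

lemma frobNorm_sub_Zmat_mul_sq {n d p : ℕ} {S : Matrix (Fin n × Fin d) (Fin p) ℝ}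
    (hS : StiefelBlocks S) {Q : Matrix (Fin d) (Fin p) ℝ} (hQ : Q * Qᵀ = 1) :
    frobNorm (S - Zmat n d * Q) ^ 2 = 2 * (n * d - ((Zmat n d)ᵀ * S * Qᵀ).trace) := by
  have hblock (j : Fin n) : ∑ k, ∑ l, ((S - Zmat n d * Q) (j, k) l) ^ 2 =
      2 * d - 2 * (rowBlk S j * Qᵀ).trace := by
    have hdiff (k : Fin d) (l : Fin p) :
        (S - Zmat n d * Q) (j, k) l = (rowBlk S j - Q) k l := by
      simp [Matrix.mul_apply, Zmat, rowBlk]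
    have hcross : (Q * (rowBlk S j)ᵀ).trace = (rowBlk S j * Qᵀ).trace := by
      rw [← Matrix.trace_transpose, Matrix.transpose_mul, Matrix.transpose_transpose]
    simp only [hdiff]
    rw [sum_sum_sq_eq_trace, Matrix.transpose_sub, Matrix.sub_mul, Matrix.mul_sub,
      Matrix.mul_sub, hS j, hQ, Matrix.trace_sub, Matrix.trace_sub, Matrix.trace_sub, hcross,
      Matrix.trace_one, Fintype.card_fin]
    ring
  rw [frobNorm, Real.sq_sqrt (by positivity), Fintype.sum_prod_type]
  simp only [hblock]
  rw [Zmat_transpose_mul, Matrix.sum_mul, Matrix.trace_sum, Finset.sum_sub_distrib,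
    ← Finset.mul_sum, ← Finset.mul_sum]
  simp
  ring

/-- The distance to the diagonal controls the nuclear-norm deficit. -/
lemma nuclearNorm_deficit_le_dF_sq {n d p : ℕ} (hn : 0 < n)
    {S : Matrix (Fin n × Fin d) (Fin p) ℝ} (hS : StiefelBlocks S) :
    2 * (n * d - nuclearNorm ((Zmat n d)ᵀ * S)) ≤ dF S ^ 2 := by
  have hle : Real.sqrt (2 * (n * d - nuclearNorm ((Zmat n d)ᵀ * S))) ≤ dF S := by
    refine le_csInf ⟨_, rowBlk S ⟨0, hn⟩, hS _, rfl⟩ ?_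
    rintro _ ⟨Q, hQ, rfl⟩
    refine Real.sqrt_le_iff.mpr ⟨Real.sqrt_nonneg _, ?_⟩
    rw [frobNorm_sub_Zmat_mul_sq hS hQ]
    linarith [trace_mul_transpose_le_nuclearNorm ((Zmat n d)ᵀ * S) hQ]
  exact (Real.sqrt_le_left ((Real.sqrt_nonneg _).trans hle)).mp hle

/-- singular values of `ZᵀS` under the proximity condition (Lemma 5.5). -/
theorem singvals_under_proximity {n d p : ℕ} (hn : 2 ≤ n) (hd : 1 ≤ d) (hp : d ≤ p)
    (Δ : Matrix (Fin n × Fin d) (Fin n × Fin d) ℝ)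
    (hΔsym : Δ.IsSymm) (hΔdiag : ∀ i, blk Δ i i = 0)
    (δ : ℝ) (hδ : 0 < δ)
    (S : Matrix (Fin n × Fin d) (Fin p) ℝ) (hS : StiefelBlocks S)
    (hprox : dF S ≤ δ * Real.sqrt ((d : ℝ) / n) * opNorm Δ) :
    ∀ i : Fin d,
      (n : ℝ) - δ ^ 2 * d * opNorm Δ ^ 2 / (2 * n) ≤ singVals ((Zmat n d)ᵀ * S) i ∧
      singVals ((Zmat n d)ᵀ * S) i ≤ n := by
  intro i
  have hle := singVals_Zmat_transpose_mul_le hS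
  refine ⟨?_, hle i⟩
  have hn0 : 0 < n := by omega
  have hnuc := nuclearNorm_deficit_le_dF_sq hn0 hS
  have hdF : 0 ≤ dF S := Real.sInf_nonneg (by rintro _ ⟨Q, -, rfl⟩; exact Real.sqrt_nonneg _)
  have hsq : dF S ^ 2 ≤ δ ^ 2 * (d / n) * opNorm Δ ^ 2 := by
    refine (pow_le_pow_left₀ hdF hprox 2).trans_eq ?_
    rw [mul_pow, mul_pow, Real.sq_sqrt (by positivity)]
  have hsingle : (n : ℝ) - singVals ((Zmat n d)ᵀ * S) i ≤
      n * d - nuclearNorm ((Zmat n d)ᵀ * S) := by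
    refine (Finset.single_le_sum (f := fun k => (n : ℝ) - singVals ((Zmat n d)ᵀ * S) k)
      (fun k _ => sub_nonneg.mpr (hle k)) (Finset.mem_univ i)).trans_eq ?_
    rw [Finset.sum_sub_distrib, nuclearNorm]
    simp [mul_comm]
  have hbound : δ ^ 2 * d * opNorm Δ ^ 2 / (2 * n) =
      δ ^ 2 * ((d : ℝ) / n) * opNorm Δ ^ 2 / 2 := by
    field_simp
  rw [hbound]
  linarith
end
end
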